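/- arXiv:1902.04159 — 5 statements merged into one kernel-verified Lean document; each statement's English description precedes it below -/
import Mathlib

section
/- Let K be a nontrivial Kollár quasivariety with the joint embedding property. If the class of all relatively simple members of K is an elementary class (i.e., the model class of a set of first-order sentences), then this class of relatively simple members itself has the joint embedding property. -/
universe u

open FirstOrder Language Structure

namespace Paper

variable {L : FirstOrder.Language.{u, u}}

/-- Existential positive sentences/formulas: built from atomic formulas by
conjunction, disjunction and existential quantification. -/
inductive IsEP : {n : ℕ} → L.BoundedFormula Empty n → Prop
  | equal {n} (t₁ t₂ : L.Term (Empty ⊕ Fin n)) : IsEP (t₁.bdEqual t₂)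
  | rel {n k} (R : L.Relations k) (ts : Fin k → L.Term (Empty ⊕ Fin n)) :
      IsEP (BoundedFormula.rel R ts)
  | sup {n} {φ ψ : L.BoundedFormula Empty n} : IsEP φ → IsEP ψ → IsEP (φ ⊔ ψ)
  | inf {n} {φ ψ : L.BoundedFormula Empty n} : IsEP φ → IsEP ψ → IsEP (φ ⊓ ψ)
  | ex {n} {φ : L.BoundedFormula Empty (n + 1)} : IsEP φ → IsEP φ.ex

/-- The direct-product structure on a product of structures. -/
def piStructure {ι : Type u} (M : ι → Type u) [∀ i, L.Structure (M i)] :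
    L.Structure (∀ i, M i) where
  funMap f x i := funMap f fun j => x j i
  RelMap r x := ∀ i, RelMap r fun j => x j i

/-- An (abstract) class of `L`-structures with universes in `Type u`. -/
def StructClass (L : FirstOrder.Language.{u, u}) : Type (u + 1) :=
  ∀ M : Type u, L.Structure M → Prop

def SubClass (K₁ K₂ : StructClass L) : Prop :=
  ∀ (M : Type u) (iM : L.Structure M), K₁ M iM → K₂ M iM

def EqClass (K₁ K₂ : StructClass L) : Prop :=
  ∀ (M : Type u) (iM : L.Structure M), K₁ M iM ↔ K₂ M iM

/-- A quasivariety: a class of structures closed under isomorphisms,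
substructures, direct products and ultraproducts. -/
structure IsQuasivariety (K : StructClass L) : Prop where
  iso_closed : ∀ (M : Type u) [iM : L.Structure M] (N : Type u) [iN : L.Structure N],
      Nonempty (M ≃[L] N) → K M iM → K N iN
  sub_closed : ∀ (M : Type u) [iM : L.Structure M] (N : Type u) [iN : L.Structure N],
      Nonempty (M ↪[L] N) → K N iN → K M iM
  prod_closed : ∀ (ι : Type u) (M : ι → Type u) [iM : ∀ i, L.Structure (M i)],
      (∀ i, K (M i) (iM i)) → K (∀ i, M i) (piStructure M)
  ultra_closed : ∀ (ι : Type u) (M : ι → Type u) [iM : ∀ i, L.Structure (M i)]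
      (uf : Ultrafilter ι), (∀ i, K (M i) (iM i)) →
      K ((uf : Filter ι).Product M) inferInstance

/-- A variety: a class of structures closed under isomorphisms, homomorphic
images, substructures and direct products. -/
structure IsVariety (K : StructClass L) : Prop where
  iso_closed : ∀ (M : Type u) [iM : L.Structure M] (N : Type u) [iN : L.Structure N],
      Nonempty (M ≃[L] N) → K M iM → K N iN
  hom_closed : ∀ (M : Type u) [iM : L.Structure M] (N : Type u) [iN : L.Structure N],
      (∃ h : M →[L] N, Function.Surjective h) → K M iM → K N iN
  sub_closed : ∀ (M : Type u) [iM : L.Structure M] (N : Type u) [iN : L.Structure N],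
      Nonempty (M ↪[L] N) → K N iN → K M iM
  prod_closed : ∀ (ι : Type u) (M : ι → Type u) [iM : ∀ i, L.Structure (M i)],
      (∀ i, K (M i) (iM i)) → K (∀ i, M i) (piStructure M)

/-- The quasivariety generated by a class. -/
def QGen (C : StructClass L) : StructClass L :=
  fun M iM => ∀ K : StructClass L, IsQuasivariety K → SubClass C K → K M iM

/-- The variety generated by a class. -/
def VGen (C : StructClass L) : StructClass L :=
  fun M iM => ∀ K : StructClass L, IsVariety K → SubClass C K → K M iM

/-- The class of isomorphic copies of a single structure. -/
def ClassOf (A : Type u) [iA : L.Structure A] : StructClass L :=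
  fun M iM => Nonempty (@FirstOrder.Language.Equiv L M A iM iA)

/-- A class is nontrivial when it has a member with at least two elements. -/
def NontrivialClass (K : StructClass L) : Prop :=
  ∃ (M : Type u) (iM : L.Structure M), K M iM ∧ Nontrivial M

/-- The joint embedding property. -/
def HasJEP (K : StructClass L) : Prop :=
  ∀ (A : Type u) [iA : L.Structure A] (B : Type u) [iB : L.Structure B],
    K A iA → K B iB → Nontrivial A → Nontrivial B →
    ∃ (C : Type u) (iC : L.Structure C), K C iC ∧
      Nonempty (@FirstOrder.Language.Embedding L A C iA iC) ∧
      Nonempty (@FirstOrder.Language.Embedding L B C iB iC)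

/-- There is a homomorphism from `A` into some ultrapower of `B`. -/
def MapsIntoUltrapower (L : FirstOrder.Language.{u, u}) (A B : Type u)
    [iA : L.Structure A] [iB : L.Structure B] : Prop :=
  ∃ (ι : Type u) (uf : Ultrafilter ι),
    Nonempty (A →[L] ((uf : Filter ι).Product fun _ : ι => B))

/-- There is an embedding of `A` into some ultrapower of `B`. -/
def EmbedsIntoUltrapower (L : FirstOrder.Language.{u, u}) (A B : Type u)
    [iA : L.Structure A] [iB : L.Structure B] : Prop :=
  ∃ (ι : Type u) (uf : Ultrafilter ι),
    Nonempty (A ↪[L] ((uf : Filter ι).Product fun _ : ι => B))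

/-- Passive structural completeness: all nontrivial members satisfy the same
existential positive sentences. -/
def IsPSC (K : StructClass L) : Prop :=
  ∀ (A : Type u) [iA : L.Structure A] (B : Type u) [iB : L.Structure B],
    K A iA → K B iB → Nontrivial A → Nontrivial B →
    ∀ φ : L.Sentence, IsEP φ → (A ⊨ φ → B ⊨ φ)

/-- A relatively simple (K-simple) member of `K`. -/
def RelSimple (K : StructClass L) (A : Type u) [iA : L.Structure A] : Prop :=
  K A iA ∧ Nontrivial A ∧
    ∀ (B : Type u) [iB : L.Structure B], K B iB → Nontrivial B →
      ∀ h : A →[L] B, Function.Surjective h → Function.Injective h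

/-- The class of relatively simple members of `K`. -/
def RelSimpleClass (K : StructClass L) : StructClass L :=
  fun A iA => @RelSimple L K A iA

/-- A relatively subdirectly irreducible member of `K`. -/
def RelSDI (K : StructClass L) (A : Type u) [iA : L.Structure A] : Prop :=
  K A iA ∧
    ∀ (ι : Type u) (M : ι → Type u) [iM : ∀ i, L.Structure (M i)],
      (∀ i, K (M i) (iM i)) →
      ∀ h : @FirstOrder.Language.Embedding L A (∀ i, M i) iA (piStructure M),
        (∀ i, Function.Surjective fun a => h a i) →
        ∃ i, Function.Bijective fun a => h a i

/-- The class of relatively subdirectly irreducible members of `K`. -/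
def RelSDIClass (K : StructClass L) : StructClass L :=
  fun A iA => @RelSDI L K A iA

/-- `K` is relatively semisimple. -/
def RelSemisimple (K : StructClass L) : Prop :=
  ∀ (M : Type u) [iM : L.Structure M], K M iM → RelSDI K M → RelSimple K M

/-- A congruence of a structure. -/
def IsCong (L : FirstOrder.Language.{u, u}) (A : Type u) [iA : L.Structure A] (θ : Setoid A) : Prop :=
  (∀ (n : ℕ) (f : L.Functions n) (x y : Fin n → A),
      (∀ i, θ.r (x i) (y i)) → θ.r (funMap f x) (funMap f y)) ∧
  (∀ (n : ℕ) (r : L.Relations n) (x y : Fin n → A),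
      (∀ i, θ.r (x i) (y i)) → (RelMap r x ↔ RelMap r y))

/-- The prestructure determined by a congruence. -/
def congPrestructure (L : FirstOrder.Language.{u, u}) (A : Type u) [iA : L.Structure A]
    (θ : Setoid A) (h : IsCong L A θ) : L.Prestructure θ where
  toStructure := iA
  fun_equiv := fun x y hxy => h.1 _ _ x y fun i => hxy i
  rel_equiv := fun x y hxy => propext (h.2 _ _ x y fun i => hxy i)

/-- The quotient structure by a congruence. -/
def quotStructure (L : FirstOrder.Language.{u, u}) (A : Type u) [iA : L.Structure A]
    (θ : Setoid A) (h : IsCong L A θ) : L.Structure (Quotient θ) :=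
  @FirstOrder.Language.quotientStructure L A θ (congPrestructure L A θ h)

/-- A `K`-congruence (relative congruence) of `A`. -/
def IsKCong (K : StructClass L) (A : Type u) [iA : L.Structure A] (θ : Setoid A) : Prop :=
  ∃ h : IsCong L A θ, K (Quotient θ) (quotStructure L A θ h)

/-- The total relation `A × A` is a compact element of the lattice of
`K`-congruences of `A`. -/
def TopKCompact (K : StructClass L) (A : Type u) [iA : L.Structure A] : Prop :=
  ∀ S : Set (Setoid A), (∀ θ ∈ S, IsKCong K A θ) →
    (∀ θ : Setoid A, IsKCong K A θ → (∀ σ ∈ S, σ ≤ θ) → θ = ⊤) →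
    ∃ S₀ : Set (Setoid A), S₀ ⊆ S ∧ S₀.Finite ∧
      ∀ θ : Setoid A, IsKCong K A θ → (∀ σ ∈ S₀, σ ≤ θ) → θ = ⊤

/-- `A` has a homomorphic image in `K` that is `K`-simple. -/
def HasRelSimpleImage (K : StructClass L) (A : Type u) [iA : L.Structure A] : Prop :=
  ∃ (B : Type u) (iB : L.Structure B), K B iB ∧
    (∃ h : @FirstOrder.Language.Hom L A B iA iB, Function.Surjective h) ∧
    @RelSimple L K B iB

/-- The language has finitely many operation and relation symbols. -/
def FiniteType (L : FirstOrder.Language.{u, u}) : Prop :=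
  Finite (Σ n, L.Functions n) ∧ Finite (Σ n, L.Relations n)

/-- An algebra is `0`-generated when it is generated by the empty set. -/
def ZeroGen (L : FirstOrder.Language.{u, u}) (A : Type u) [iA : L.Structure A] : Prop :=
  Substructure.closure L (∅ : Set A) = ⊤

/-- `A` has a one-element (trivial) subalgebra. -/
def HasOneElemSub (L : FirstOrder.Language.{u, u}) (A : Type u) [iA : L.Structure A] : Prop :=
  ∃ c : A, ∀ (n : ℕ) (f : L.Functions n), funMap f (fun _ => c) = c

/-- A Kollár class: nontrivial members have no trivial subalgebra. -/
def IsKollar (K : StructClass L) : Prop :=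
  ∀ (M : Type u) [iM : L.Structure M], K M iM → Nontrivial M → ¬ HasOneElemSub L M

/-- `A` is a retract of `B`. -/
def IsRetractOf (L : FirstOrder.Language.{u, u}) (A B : Type u)
    [iA : L.Structure A] [iB : L.Structure B] : Prop :=
  ∃ (g : A →[L] B) (h : B →[L] A), ∀ a : A, h (g a) = a

/-- Validity of an equation in a class. -/
def EqValid (K : StructClass L) (t₁ t₂ : L.Term ℕ) : Prop :=
  ∀ (M : Type u) [iM : L.Structure M], K M iM →
    ∀ v : ℕ → M, t₁.realize v = t₂.realize v

/-- Validity of a quasi-equation (with premise set `Γ`) in a class. -/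
def QEqValid (K : StructClass L) (Γ : Set (L.Term ℕ × L.Term ℕ))
    (t₁ t₂ : L.Term ℕ) : Prop :=
  ∀ (M : Type u) [iM : L.Structure M], K M iM → ∀ v : ℕ → M,
    (∀ p ∈ Γ, Term.realize v p.1 = Term.realize v p.2) →
    t₁.realize v = t₂.realize v

/-- A set of equations is unifiable over `K`. -/
def Unifiable (K : StructClass L) (Γ : Set (L.Term ℕ × L.Term ℕ)) : Prop :=
  ∃ h : ℕ → L.Term ℕ, ∀ p ∈ Γ, EqValid K (p.1.subst h) (p.2.subst h)

/-- No quasi-equation is passive over `K`: every finite set of equations is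
unifiable over `K`. -/
def NoPassiveQEq (K : StructClass L) : Prop :=
  ∀ Γ : Set (L.Term ℕ × L.Term ℕ), Γ.Finite → Unifiable K Γ

/-- The set of variables occurring in a set of equations. -/
def EqnsVars (Γ : Set (L.Term ℕ × L.Term ℕ)) : Set ℕ :=
  ⋃ p ∈ Γ, (↑(p.1.varFinset ∪ p.2.varFinset) : Set ℕ)

/-- `F` is a free `1`-generated algebra for `K`, with free generator `x`. -/
def IsFreeOne (K : StructClass L) (F : Type u) [iF : L.Structure F] (x : F) : Prop :=
  K F iF ∧ Substructure.closure L ({x} : Set F) = ⊤ ∧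
    ∀ (M : Type u) [iM : L.Structure M], K M iM → ∀ m : M,
      ∃ h : F →[L] M, h x = m

/-- A minimal quasivariety. -/
def MinimalQV (K : StructClass L) : Prop :=
  NontrivialClass K ∧ ∀ K' : StructClass L, IsQuasivariety K' → SubClass K' K →
    NontrivialClass K' → EqClass K' K

/-- A trivial class: all members have at most one element. -/
def TrivialClass (K : StructClass L) : Prop :=
  ∀ (M : Type u) [iM : L.Structure M], K M iM → Subsingleton M

/-- The congruence of `A` generated by the pair `(a, b)`. -/
def congGen (L : FirstOrder.Language.{u, u}) (A : Type u) [iA : L.Structure A] (a b : A) : Setoid A :=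
  sInf {θ : Setoid A | IsCong L A θ ∧ θ.r a b}

/-- Equationally definable principal congruences. -/
def HasEDPC (K : StructClass L) : Prop :=
  ∃ S : Finset (L.Term (Fin 4) × L.Term (Fin 4)),
    ∀ (M : Type u) [iM : L.Structure M], K M iM → ∀ a b c d : M,
      ((congGen L M a b).r c d ↔
        ∀ p ∈ S, Term.realize ![a, b, c, d] p.1 = Term.realize ![a, b, c, d] p.2)

/-- A simple algebra: nontrivial, and its only congruences are the identity
and the total relation. -/
def IsSimpleAlg (L : FirstOrder.Language.{u, u}) (A : Type u) [iA : L.Structure A] : Prop :=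
  Nontrivial A ∧ ∀ θ : Setoid A, IsCong L A θ → θ = ⊥ ∨ θ = ⊤

/-- Structural completeness: every subquasivariety generating the same variety
coincides with the class itself. -/
def IsSC (K : StructClass L) : Prop :=
  ∀ K' : StructClass L, IsQuasivariety K' → SubClass K' K →
    EqClass (VGen K') (VGen K) → EqClass K' K


section Ultraproduct

variable {ι : Type u} (uf : Ultrafilter ι) {M : ι → Type u} [∀ i, L.Structure (M i)]

theorem ultraproduct_mk_eq_iff (x y : ∀ i, M i) :
    (Quotient.mk ((uf : Filter ι).productSetoid M) x = Quotient.mk _ y) ↔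
      ∀ᶠ i in (uf : Filter ι), x i = y i :=
  Quotient.eq

theorem ultraproduct_nontrivial [∀ i, Nontrivial (M i)] :
    Nontrivial ((uf : Filter ι).Product M) := by
  choose x y hxy using fun i => exists_pair_ne (M i)
  refine ⟨Quotient.mk _ x, Quotient.mk _ y, fun h => ?_⟩
  obtain ⟨i, hi⟩ := ((ultraproduct_mk_eq_iff uf x y).1 h).exists
  exact hxy i hi

/-- A family of homomorphisms out of an algebra induces one into the ultraproduct. -/
def ultraproductLift (halg : L.IsAlgebraic) {A : Type u} [L.Structure A]
    (h : ∀ i, A →[L] M i) : A →[L] ((uf : Filter ι).Product M) where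
  toFun a := Quotient.mk _ fun i => h i a
  map_fun' f x := by
    have := Ultraproduct.funMap_cast (u := uf) f fun j i => h i (x j)
    refine Eq.trans ?_ this.symm
    exact congrArg (Quotient.mk _) (funext fun i => (h i).map_fun f x)
  map_rel' r := (halg _).elim r

end Ultraproduct

variable {K : StructClass L}

theorem IsKollar.exists_map_ne (hkol : IsKollar K) {A B : Type u} [L.Structure A]
    [iB : L.Structure B] [Nonempty A] (hB : K B iB) [hn : Nontrivial B] (h : A →[L] B) :
    ∃ a b, h a ≠ h b := by
  by_contra! hc
  obtain ⟨a⟩ := ‹Nonempty A›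
  refine hkol B hB hn ⟨h a, fun n f => ?_⟩
  exact (h.map_fun f fun _ => a).symm.trans (hc _ _)

theorem IsKollar.range_mem (hK : IsQuasivariety K) (hkol : IsKollar K) {A B : Type u}
    [L.Structure A] [iB : L.Structure B] [Nonempty A] (hB : K B iB) [Nontrivial B]
    (h : A →[L] B) : K h.range inferInstance ∧ Nontrivial h.range := by
  refine ⟨hK.sub_closed _ B ⟨h.range.subtype⟩ hB, ?_⟩
  obtain ⟨a, b, hab⟩ := hkol.exists_map_ne hB h
  exact ⟨⟨h a, a, rfl⟩, ⟨h b, b, rfl⟩, fun e => hab (congrArg Subtype.val e)⟩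

/-- The corestriction of a homomorphism of algebras to its range. -/
def homToRange (halg : L.IsAlgebraic) {A B : Type u} [L.Structure A] [L.Structure B]
    (h : A →[L] B) : A →[L] h.range where
  toFun a := ⟨h a, a, rfl⟩
  map_fun' f x := Subtype.ext (h.map_fun f x)
  map_rel' r := (halg _).elim r

theorem homToRange_surjective (halg : L.IsAlgebraic) {A B : Type u} [L.Structure A]
    [L.Structure B] (h : A →[L] B) : Function.Surjective (homToRange halg h) := by
  rintro ⟨_, a, rfl⟩
  exact ⟨a, rfl⟩

/-- The kernels of homomorphisms from `A` to nontrivial members of `K`. -/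
def properKernels (K : StructClass L) (A : Type u) [L.Structure A] : Set (Setoid A) :=
  {θ | ∃ (B : Type u) (iB : L.Structure B) (h : A →[L] B),
    K B iB ∧ Nontrivial B ∧ Setoid.ker h = θ}

theorem exists_upperBound_properKernels (halg : L.IsAlgebraic) (hK : IsQuasivariety K)
    (A : Type u) [L.Structure A] {c : Set (Setoid A)} (hc : c ⊆ properKernels K A)
    (hchain : IsChain (· ≤ ·) c) (hne : c.Nonempty) :
    ∃ θ ∈ properKernels K A, ∀ σ ∈ c, σ ≤ θ := by
  choose B iB h hB hnt hker using fun σ : c => hc σ.2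
  have : Nonempty c := hne.to_subtype
  have : IsDirectedOrder c := directedOn_iff_isDirectedOrder.1 hchain.directedOn
  let uf : Ultrafilter c := Ultrafilter.of Filter.atTop
  let g : A →[L] ((uf : Filter c).Product B) := ultraproductLift uf halg h
  refine ⟨Setoid.ker g, ⟨_, _, g, hK.ultra_closed c B uf hB, ultraproduct_nontrivial uf, rfl⟩,
    fun σ hσ a b hab => ?_⟩
  refine (ultraproduct_mk_eq_iff uf _ _).2 (Ultrafilter.of_le _ ?_)
  filter_upwards [Filter.eventually_ge_atTop (⟨σ, hσ⟩ : c)] with τ hτ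
  have hab' : (τ : Setoid A) a b := hτ hab
  rwa [← hker τ] at hab'

/-- In a Kollár quasivariety of algebras, every nontrivial member has a homomorphism to a
relatively simple member. -/
theorem exists_hom_relSimple (halg : L.IsAlgebraic) (hK : IsQuasivariety K)
    (hkol : IsKollar K) (A : Type u) [iA : L.Structure A] (hA : K A iA) [Nontrivial A] :
    ∃ (D : Type u) (iD : L.Structure D), RelSimple K D ∧ Nonempty (A →[L] D) := by
  obtain ⟨θ, -, hθ⟩ := zorn_le_nonempty₀ (properKernels K A)
    (fun c hc hchain σ hσ => exists_upperBound_properKernels halg hK A hc hchain ⟨σ, hσ⟩)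
    _ ⟨A, iA, Hom.id L A, hA, inferInstance, rfl⟩
  obtain ⟨B, iB, h, hB, hBnt, rfl⟩ := hθ.prop
  obtain ⟨hR, hRnt⟩ := IsKollar.range_mem hK hkol hB h
  refine ⟨h.range, inferInstance, ⟨hR, hRnt, fun E iE hE hEnt g _ => ?_⟩, ⟨homToRange halg h⟩⟩
  have hle : Setoid.ker h ≤ Setoid.ker (g.comp (homToRange halg h)) := fun a b hab =>
    congrArg g (Subtype.ext hab)
  have hge := hθ.le_of_ge ⟨E, iE, _, hE, hEnt, rfl⟩ hle
  rintro ⟨_, a, rfl⟩ ⟨_, b, rfl⟩ hab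
  exact Subtype.ext (@hge a b hab)

/-- In a Kollár quasivariety of algebras, homomorphisms from relatively simple members to
nontrivial members are embeddings. -/
theorem RelSimple.nonempty_embedding (halg : L.IsAlgebraic) (hK : IsQuasivariety K)
    (hkol : IsKollar K) {A B : Type u} [L.Structure A] [iB : L.Structure B]
    (hA : RelSimple K A) (hB : K B iB) [Nontrivial B] (h : A →[L] B) :
    Nonempty (A ↪[L] B) := by
  have : Nontrivial A := hA.2.1
  obtain ⟨hR, hRnt⟩ := IsKollar.range_mem hK hkol hB h
  have hinj := hA.2.2 _ hR hRnt _ (homToRange_surjective halg h)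
  exact ⟨{ toFun := h
           inj' := fun a b hab => hinj (Subtype.ext hab)
           map_fun' := h.map_fun
           map_rel' := fun r => (halg _).elim r }⟩

/-- if the class of relatively simple members of a nontrivial
Kollár quasivariety with the JEP is elementary, then it has the JEP. -/
theorem statement_9 (L : FirstOrder.Language.{u, u}) (halg : L.IsAlgebraic)
    (K : StructClass L) (hK : IsQuasivariety K) (hkol : IsKollar K)
    (hnt : NontrivialClass K) (hjep : HasJEP K)
    (helem : ∃ T : L.Theory, ∀ (M : Type u) (iM : L.Structure M),
      @RelSimple L K M iM ↔ @FirstOrder.Language.Theory.Model L M iM T) :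
    HasJEP (RelSimpleClass K) := by
  intro A _ B _ hA hB hAnt hBnt
  obtain ⟨C, iC, hC, ⟨f⟩, ⟨g⟩⟩ := hjep A B hA.1 hB.1 hAnt hBnt
  have : Nontrivial C := f.injective.nontrivial
  obtain ⟨D, iD, hD, ⟨k⟩⟩ := exists_hom_relSimple halg hK hkol C hC
  have : Nontrivial D := hD.2.1
  exact ⟨D, iD, hD,
    RelSimple.nonempty_embedding halg hK hkol hA hD.1 (k.comp f.toHom),
    RelSimple.nonempty_embedding halg hK hkol hB hD.1 (k.comp g.toHom)⟩

end Paper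
end

section
/- Let K be an algebraic variety with equationally definable principal congruences. Then for every simple algebra A ∈ K, the variety V(A) generated by A has the joint embedding property; indeed V(A) = Q(A). -/
universe u

open FirstOrder Language Structure

namespace Paper

variable {L : FirstOrder.Language.{u, u}}

section Ultraproducts

variable {ι : Type u} {M : ι → Type u} {U : Ultrafilter ι}

/-- The class of a family in an ultraproduct. -/
def toUltra (U : Ultrafilter ι) (x : ∀ i, M i) : (U : Filter ι).Product M := x

theorem toUltra_eq_iff {x y : ∀ i, M i} :
    toUltra U x = toUltra U y ↔ ∀ᶠ i in (U : Filter ι), x i = y i :=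
  Quotient.eq''

theorem toUltra_surjective : Function.Surjective (toUltra (M := M) U) :=
  fun x => Quotient.inductionOn' x fun y => ⟨y, rfl⟩

variable [∀ i, L.Structure (M i)]

theorem funMap_toUltra {n : ℕ} (f : L.Functions n) (x : Fin n → ∀ i, M i) :
    (funMap f fun j => toUltra U (x j)) = toUltra U fun i => funMap f fun j => x j i :=
  Ultraproduct.funMap_cast f x

theorem realize_toUltra {β : Type*} (x : β → ∀ i, M i) (t : L.Term β) :
    (t.realize fun j => toUltra U (x j)) = toUltra U fun i => t.realize fun j => x j i :=
  Ultraproduct.term_realize_cast x t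

/-- The canonical homomorphism induced by a family of homomorphisms into the factors of an
ultraproduct. -/
def homUltra [L.IsAlgebraic] {N : Type u} [L.Structure N] (U : Ultrafilter ι)
    (f : ∀ i, N →[L] M i) : N →[L] (U : Filter ι).Product M where
  toFun n := toUltra U fun i => f i n
  map_fun' g x := by
    change _ = funMap g fun j => toUltra U fun i => f i (x j)
    rw [funMap_toUltra]
    exact congrArg _ (funext fun i => (f i).map_fun g x)
  map_rel' := isEmptyElim

theorem homUltra_injective [L.IsAlgebraic] {N : Type u} [L.Structure N] (U : Ultrafilter ι)
    (f : ∀ i, N ↪[L] M i) : Function.Injective (homUltra U fun i => (f i).toHom) := by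
  intro x y h
  obtain ⟨i, hi⟩ := (toUltra_eq_iff.1 h).exists
  exact (f i).injective hi

/-- A family of embeddings induces an embedding of ultraproducts. -/
theorem nonempty_ultraproduct_embedding [L.IsAlgebraic] {N : ι → Type u}
    [∀ i, L.Structure (N i)] (f : ∀ i, M i ↪[L] N i) :
    Nonempty ((U : Filter ι).Product M ↪[L] (U : Filter ι).Product N) := by
  choose s hs using toUltra_surjective (M := M) (U := U)
  let g : (U : Filter ι).Product M → (U : Filter ι).Product N := fun x =>
    toUltra U fun i => f i (s x i)
  have hg : ∀ x : ∀ i, M i, g (toUltra U x) = toUltra U fun i => f i (x i) := fun x =>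
    toUltra_eq_iff.2 ((toUltra_eq_iff.1 (hs (toUltra U x))).mono fun i hi => congrArg (f i) hi)
  let φ : (U : Filter ι).Product M →[L] (U : Filter ι).Product N :=
    { toFun := g
      map_fun' := fun {n} k x => by
        obtain ⟨y, rfl⟩ : ∃ y : Fin n → ∀ i, M i, x = fun j => toUltra U (y j) :=
          ⟨fun j => s (x j), funext fun j => (hs _).symm⟩
        have h : g ∘ (fun j => toUltra U (y j)) = fun j => toUltra U fun i => f i (y j i) :=
          funext fun j => hg (y j)
        rw [funMap_toUltra, hg, h, funMap_toUltra]
        exact congrArg _ (funext fun i => (f i).map_fun k _)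
      map_rel' := isEmptyElim }
  have hφ : Function.Injective φ := by
    intro x y h
    rw [← hs x, ← hs y]
    exact toUltra_eq_iff.2 ((toUltra_eq_iff.1 h).mono fun i hi => (f i).injective hi)
  exact ⟨Embedding.ofInjective hφ⟩

end Ultraproducts

theorem qGen_isQuasivariety (C : StructClass L) : IsQuasivariety (QGen C) where
  iso_closed M _ N _ e h K hK hC := hK.iso_closed M N e (h K hK hC)
  sub_closed M _ N _ e h K hK hC := hK.sub_closed M N e (h K hK hC)
  prod_closed ι M _ h K hK hC := hK.prod_closed ι M fun i => h i K hK hC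
  ultra_closed ι M _ U h K hK hC := hK.ultra_closed ι M U fun i => h i K hK hC

/-- In an algebraic language every ultraproduct is a homomorphic image of the direct product. -/
theorem IsVariety.isQuasivariety [L.IsAlgebraic] {K : StructClass L} (hK : IsVariety K) :
    IsQuasivariety K where
  iso_closed := hK.iso_closed
  sub_closed := hK.sub_closed
  prod_closed := hK.prod_closed
  ultra_closed ι M _ U h := by
    let := piStructure (L := L) M
    refine hK.hom_closed (∀ i, M i) _
      ⟨{ toFun := toUltra U, map_fun' := fun f x => (funMap_toUltra f x).symm,
         map_rel' := isEmptyElim }, toUltra_surjective⟩ (hK.prod_closed ι M h)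

theorem subClass_qGen (C : StructClass L) : SubClass C (QGen C) :=
  fun M iM h _ _ hC => hC M iM h

theorem qGen_subClass_vGen [L.IsAlgebraic] (C : StructClass L) : SubClass (QGen C) (VGen C) :=
  fun _ _ h K hK hC => h K hK.isQuasivariety hC

theorem classOf_self (A : Type u) [iA : L.Structure A] : ClassOf A A iA :=
  ⟨Language.Equiv.refl L A⟩

theorem ClassOf.subClass {A : Type u} [iA : L.Structure A] {K : StructClass L}
    (hiso : ∀ (M : Type u) [iM : L.Structure M] (N : Type u) [iN : L.Structure N],
      Nonempty (M ≃[L] N) → K M iM → K N iN) (hA : K A iA) :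
    SubClass (ClassOf A) K := by
  rintro M iM ⟨e⟩
  exact hiso A M ⟨e.symm⟩ hA

/-- The closure of a single structure under ultraproducts. -/
inductive UltraClosure (A : Type u) [iA : L.Structure A] : StructClass L
  | base : UltraClosure A A iA
  | ultra (ι : Type u) (M : ι → Type u) [iM : ∀ i, L.Structure (M i)] (U : Ultrafilter ι)
      (h : ∀ i, UltraClosure A (M i) (iM i)) :
      UltraClosure A ((U : Filter ι).Product M) inferInstance

theorem UltraClosure.mem_of_isQuasivariety {A : Type u} [iA : L.Structure A] {K : StructClass L}
    (hK : IsQuasivariety K) (hA : K A iA) {B : Type u} [iB : L.Structure B]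
    (hB : UltraClosure A B iB) : K B iB := by
  induction hB with
  | base => exact hA
  | ultra ι M U _ ih => exact hK.ultra_closed ι M U ih

/-- Two structures embed into a common member of a class. -/
def JointEmbed (K : StructClass L) (B B' : Type u) [L.Structure B] [L.Structure B'] : Prop :=
  ∃ (D : Type u) (iD : L.Structure D), K D iD ∧ Nonempty (B ↪[L] D) ∧ Nonempty (B' ↪[L] D)

theorem JointEmbed.symm {K : StructClass L} {B B' : Type u} [L.Structure B] [L.Structure B']
    (h : JointEmbed K B B') : JointEmbed K B' B := by
  obtain ⟨D, iD, hD, h₁, h₂⟩ := h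
  exact ⟨D, iD, hD, h₂, h₁⟩

theorem JointEmbed.ultraproduct [L.IsAlgebraic] {K : StructClass L} (hK : IsQuasivariety K)
    {ι : Type u} {M : ι → Type u} [∀ i, L.Structure (M i)] (U : Ultrafilter ι)
    {B : Type u} [L.Structure B] (h : ∀ i, JointEmbed K (M i) B) :
    JointEmbed K ((U : Filter ι).Product M) B := by
  choose D iD hD h₁ h₂ using h
  exact ⟨(U : Filter ι).Product D, inferInstance, hK.ultra_closed ι D U hD,
    nonempty_ultraproduct_embedding fun i => (h₁ i).some,
    ⟨Embedding.ofInjective (homUltra_injective U fun i => (h₂ i).some)⟩⟩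

theorem UltraClosure.jointEmbed [L.IsAlgebraic] {A : Type u} [iA : L.Structure A]
    {K : StructClass L} (hK : IsQuasivariety K) (hA : K A iA) {B B' : Type u}
    [iB : L.Structure B] [iB' : L.Structure B'] (hB : UltraClosure A B iB)
    (hB' : UltraClosure A B' iB') : JointEmbed K B B' := by
  have key : JointEmbed K B A := by
    induction hB with
    | base => exact ⟨A, iA, hA, ⟨Embedding.refl L A⟩, ⟨Embedding.refl L A⟩⟩
    | ultra ι M U _ ih => exact JointEmbed.ultraproduct hK U ih
  refine JointEmbed.symm ?_
  induction hB' with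
  | base => exact key.symm
  | ultra ι M U _ ih => exact JointEmbed.ultraproduct hK U ih

/-- The quadruple `(a, b, c, d)` satisfies all the equations in `S`. -/
def SatPairs (S : Finset (L.Term (Fin 4) × L.Term (Fin 4))) {M : Type u} [L.Structure M]
    (a b c d : M) : Prop :=
  ∀ p ∈ S, Term.realize ![a, b, c, d] p.1 = Term.realize ![a, b, c, d] p.2

theorem realize_map_four {M N : Type u} [L.Structure M] [L.Structure N] (f : M →[L] N)
    (t : L.Term (Fin 4)) (a b c d : M) :
    t.realize ![f a, f b, f c, f d] = f (t.realize ![a, b, c, d]) := by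
  rw [← HomClass.realize_term f]
  congr 1
  funext i
  fin_cases i <;> rfl

theorem UltraClosure.satPairs {S : Finset (L.Term (Fin 4) × L.Term (Fin 4))} {A : Type u}
    [iA : L.Structure A] (hA : ∀ a b c d : A, a ≠ b → SatPairs S a b c d)
    {B : Type u} [iB : L.Structure B] (hB : UltraClosure A B iB) :
    ∀ a b c d : B, a ≠ b → SatPairs S a b c d := by
  induction hB with
  | base => exact hA
  | ultra ι M U _ ih =>
    intro a b c d hab p hp
    obtain ⟨a, rfl⟩ := toUltra_surjective a
    obtain ⟨b, rfl⟩ := toUltra_surjective b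
    obtain ⟨c, rfl⟩ := toUltra_surjective c
    obtain ⟨d, rfl⟩ := toUltra_surjective d
    have hv : ![toUltra U a, toUltra U b, toUltra U c, toUltra U d] =
        fun j => toUltra U (![a, b, c, d] j) := by
      funext j
      fin_cases j <;> rfl
    have hw : ∀ i, (fun j => ![a, b, c, d] j i) = ![a i, b i, c i, d i] := by
      intro i
      funext j
      fin_cases j <;> rfl
    rw [hv, realize_toUltra, realize_toUltra, toUltra_eq_iff]
    have hne : ∀ᶠ i in (U : Filter ι), a i ≠ b i :=
      Ultrafilter.eventually_not.2 fun h => hab (toUltra_eq_iff.2 h)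
    filter_upwards [hne] with i hi
    rw [hw]
    exact ih i _ _ _ _ hi p hp

theorem isCong_congGen [L.IsAlgebraic] (M : Type u) [L.Structure M] (a b : M) :
    IsCong L M (congGen L M a b) :=
  ⟨fun n f x y h θ hθ => hθ.1.1 n f x y fun i => h i θ hθ, fun _ => isEmptyElim⟩

theorem congGen_rel (M : Type u) [L.Structure M] (a b : M) : (congGen L M a b).r a b :=
  fun _ hθ => hθ.2

theorem congGen_self_rel_iff [L.IsAlgebraic] (M : Type u) [L.Structure M] (a c d : M) :
    (congGen L M a a).r c d ↔ c = d := by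
  refine ⟨fun h => h ⊥ ⟨⟨fun n f x y h => ?_, fun _ => isEmptyElim⟩, rfl⟩, ?_⟩
  · exact congrArg (funMap f) (funext h)
  · rintro rfl
    exact (congGen L M a a).refl' c

theorem IsSimpleAlg.congGen_rel [L.IsAlgebraic] {A : Type u} [L.Structure A]
    (h : IsSimpleAlg L A) {a b : A} (hab : a ≠ b) (c d : A) : (congGen L A a b).r c d := by
  rcases h.2 _ (isCong_congGen A a b) with h | h
  · have hr := Paper.congGen_rel (L := L) A a b
    rw [h] at hr
    exact (hab hr).elim
  · rw [h]
    trivial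

/-- Homomorphisms into iterated ultraproducts of `A` separate the points of `M`. -/
def SeparatedBy (L : FirstOrder.Language.{u, u}) (A : Type u) [L.Structure A]
    (M : Type u) [L.Structure M] : Prop :=
  ∀ a b : M, a ≠ b → ∃ (B : Type u) (iB : L.Structure B), UltraClosure A B iB ∧
    ∃ f : M →[L] B, f a ≠ f b

/-- The homomorphism into a direct product induced by homomorphisms into the factors. -/
def homPi [L.IsAlgebraic] {ι : Type u} {M : ι → Type u} [∀ i, L.Structure (M i)] {N : Type u}
    [L.Structure N] (f : ∀ i, N →[L] M i) : letI := piStructure (L := L) M; N →[L] (∀ i, M i) :=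
  letI := piStructure (L := L) M
  { toFun := fun n i => f i n
    map_fun' := fun g x => funext fun i => (f i).map_fun g x
    map_rel' := isEmptyElim }

theorem IsQuasivariety.mem_of_separating [L.IsAlgebraic] {K : StructClass L}
    (hK : IsQuasivariety K) {ι : Type u} {M : ι → Type u} [iM : ∀ i, L.Structure (M i)]
    (hM : ∀ i, K (M i) (iM i)) {N : Type u} [iN : L.Structure N] (f : ∀ i, N →[L] M i)
    (hf : ∀ a b : N, a ≠ b → ∃ i, f i a ≠ f i b) : K N iN := by
  let := piStructure (L := L) M
  refine hK.sub_closed N (∀ i, M i) ⟨Embedding.ofInjective (f := homPi f) fun a b h => ?_⟩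
    (hK.prod_closed ι M hM)
  by_contra hab
  obtain ⟨i, hi⟩ := hf a b hab
  exact hi (congrFun h i)

/-- A point-separated structure has a set-indexed separating family of homomorphisms. -/
theorem SeparatedBy.exists_family {A : Type u} [L.Structure A] {M : Type u} [L.Structure M]
    (h : SeparatedBy L A M) :
    ∃ (B : {p : M × M // p.1 ≠ p.2} → Type u) (iB : ∀ i, L.Structure (B i))
      (f : ∀ i, M →[L] B i), (∀ i, UltraClosure A (B i) (iB i)) ∧
        ∀ i, f i i.1.1 ≠ f i i.1.2 := by
  choose B iB hB f hf using fun i : {p : M × M // p.1 ≠ p.2} => h i.1.1 i.1.2 i.2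
  exact ⟨B, iB, f, hB, hf⟩

theorem SeparatedBy.mem [L.IsAlgebraic] {A : Type u} [iA : L.Structure A] {M : Type u}
    [iM : L.Structure M] (h : SeparatedBy L A M) {K : StructClass L} (hK : IsQuasivariety K)
    (hA : K A iA) : K M iM := by
  obtain ⟨B, iB, f, hB, hf⟩ := h.exists_family
  exact hK.mem_of_separating (fun i => (hB i).mem_of_isQuasivariety hK hA) f
    fun a b hab => ⟨⟨(a, b), hab⟩, hf _⟩

/-- If equality in the factors of all pairs from a finite set collapsed by `h` forces equality
of `c` and `d` in the factors, then `h` collapses `(c, d)`. -/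
theorem map_eq_of_forced [L.IsAlgebraic] {S : Finset (L.Term (Fin 4) × L.Term (Fin 4))}
    {M N : Type u} [L.Structure M] [L.Structure N] (h : M →[L] N)
    (hN : ∀ a b c d : N, (congGen L N a b).r c d ↔ SatPairs S a b c d)
    {ι : Type u} {B : ι → Type u} [∀ i, L.Structure (B i)]
    (hB : ∀ i (a b c d : B i), (a ≠ b ∨ c = d) → SatPairs S a b c d)
    (f : ∀ i, M →[L] B i) (hf : ∀ a b : M, a ≠ b → ∃ i, f i a ≠ f i b)
    (l : List (M × M)) (hl : ∀ p ∈ l, h p.1 = h p.2) (c d : M)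
    (hcd : ∀ i, (∀ p ∈ l, f i p.1 = f i p.2) → f i c = f i d) : h c = h d := by
  induction l generalizing c d with
  | nil =>
    by_contra hne
    obtain ⟨i, hi⟩ := hf c d fun e => hne (congrArg h e)
    exact hi (hcd i (by simp))
  | cons q l ih =>
    obtain ⟨a, b⟩ := q
    have hab : h a = h b := hl (a, b) (by simp)
    have hsat : SatPairs S (h a) (h b) (h c) (h d) := by
      intro p hp
      rw [realize_map_four, realize_map_four]
      refine ih (fun p hp => hl p (by simp [hp])) _ _ fun i hi => ?_
      rw [← realize_map_four, ← realize_map_four]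
      refine hB i _ _ _ _ ?_ p hp
      by_cases hi' : f i a = f i b
      · refine Or.inr (hcd i ?_)
        simpa [hi'] using fun a b => hi (a, b)
      · exact Or.inl hi'
    rw [← hN, hab, congGen_self_rel_iff] at hsat
    exact hsat

theorem SeparatedBy.of_surjective [L.IsAlgebraic]
    {S : Finset (L.Term (Fin 4) × L.Term (Fin 4))} {A : Type u} [L.Structure A]
    {M N : Type u} [L.Structure M] [L.Structure N] (h : M →[L] N)
    (hsurj : Function.Surjective h) (hM : SeparatedBy L A M)
    (hN : ∀ a b c d : N, (congGen L N a b).r c d ↔ SatPairs S a b c d)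
    (hA : ∀ (B : Type u) [iB : L.Structure B], UltraClosure A B iB →
      ∀ a b c d : B, (a ≠ b ∨ c = d) → SatPairs S a b c d) :
    SeparatedBy L A N := by
  intro c d hcd
  obtain ⟨c, rfl⟩ := hsurj c
  obtain ⟨d, rfl⟩ := hsurj d
  obtain ⟨B, iB, f, hB, hf⟩ := hM.exists_family
  have hforced := map_eq_of_forced h hN (fun i => hA (B i) (hB i)) f
    fun a b hab => ⟨⟨(a, b), hab⟩, hf _⟩
  let E : M × M → Set {p : M × M // p.1 ≠ p.2} := fun p => {i | f i p.1 = f i p.2 ∧ f i c ≠ f i d}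
  obtain ⟨U, hU⟩ := Ultrafilter.exists_ultrafilter_of_finite_inter_nonempty
    (E '' {p | h p.1 = h p.2}) (by
      classical
      intro T hT
      obtain ⟨T', hT', rfl⟩ := Finset.subset_set_image_iff.1 hT
      by_contra hempty
      refine hcd (hforced ((c, c) :: T'.toList) ?_ c d fun i hi => ?_)
      · simpa using fun a b hab => hT' hab
      · by_contra hne
        refine hempty ⟨i, ?_⟩
        simp only [Finset.coe_image, Set.sInter_image, Set.mem_iInter]
        exact fun p hp => ⟨hi p (by simp [Finset.mem_coe.1 hp]), hne⟩)
  have hker : ∀ a b, h a = h b → homUltra U f a = homUltra U f b := fun a b hab =>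
    toUltra_eq_iff.2 (Filter.mem_of_superset (hU ⟨(a, b), hab, rfl⟩) fun i hi => hi.1)
  choose s hs using hsurj
  refine ⟨_, _, UltraClosure.ultra _ B U hB,
    { toFun := fun n => homUltra U f (s n)
      map_fun' := fun g x => ?_
      map_rel' := isEmptyElim }, fun heq => ?_⟩
  · refine Eq.trans ?_ ((homUltra U f).map_fun g (s ∘ x))
    refine hker _ _ ?_
    rw [hs, h.map_fun]
    exact congrArg _ (funext fun j => (hs (x j)).symm)
  · have heq' : homUltra U f c = homUltra U f d :=
      (hker _ _ (hs (h c))).symm.trans (heq.trans (hker _ _ (hs (h d))))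
    have hc : ∀ᶠ i in (U : Filter _), f i c ≠ f i d :=
      Filter.mem_of_superset (hU ⟨(c, c), rfl, rfl⟩) fun i hi => hi.2
    obtain ⟨i, hne, he⟩ := (hc.and (toUltra_eq_iff.1 heq')).exists
    exact hne he

/-- In the presence of equationally definable principal congruences, the members of `K` that are
separated by a simple member `A` form a variety. -/
theorem isVariety_separatedBy [L.IsAlgebraic] {K : StructClass L} (hK : IsVariety K)
    (hedpc : HasEDPC K) {A : Type u} [iA : L.Structure A] (hA : K A iA)
    (hsimple : IsSimpleAlg L A) :
    IsVariety fun M iM => K M iM ∧ @SeparatedBy L A iA M iM := by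
  obtain ⟨S, hS⟩ := hedpc
  have hsat : ∀ (B : Type u) [iB : L.Structure B], UltraClosure A B iB →
      ∀ a b c d : B, (a ≠ b ∨ c = d) → SatPairs S a b c d := by
    intro B iB hB a b c d habcd
    rcases habcd with hab | rfl
    · exact hB.satPairs (fun a b c d hab => (hS A hA a b c d).1 (hsimple.congGen_rel hab c d))
        a b c d hab
    · exact (hS B (hB.mem_of_isQuasivariety hK.isQuasivariety hA) a b c c).1
        ((congGen L B a b).refl' c)
  have hhom : ∀ (M : Type u) [iM : L.Structure M] (N : Type u) [iN : L.Structure N],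
      (∃ h : M →[L] N, Function.Surjective h) → (K M iM ∧ SeparatedBy L A M) →
        (K N iN ∧ SeparatedBy L A N) := by
    rintro M iM N iN ⟨h, hsurj⟩ ⟨hM, hsep⟩
    have hN := hK.hom_closed M N ⟨h, hsurj⟩ hM
    exact ⟨hN, hsep.of_surjective h hsurj (hS N hN) hsat⟩
  refine ⟨?_, hhom, ?_, ?_⟩
  · rintro M iM N iN ⟨e⟩
    exact hhom M N ⟨e.toHom, e.surjective⟩
  · rintro M iM N iN ⟨e⟩ ⟨hN, hsep⟩
    refine ⟨hK.sub_closed M N ⟨e⟩ hN, fun a b hab => ?_⟩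
    obtain ⟨B, iB, hB, f, hf⟩ := hsep (e a) (e b) fun h => hab (e.injective h)
    exact ⟨B, iB, hB, f.comp e.toHom, hf⟩
  · intro ι M iM h
    let := piStructure (L := L) M
    refine ⟨hK.prod_closed ι M fun i => (h i).1, fun a b hab => ?_⟩
    obtain ⟨i, hi⟩ := Function.ne_iff.1 hab
    obtain ⟨B, iB, hB, f, hf⟩ := (h i).2 (a i) (b i) hi
    let π : (∀ i, M i) →[L] M i :=
      { toFun := fun x => x i, map_fun' := fun _ _ => rfl, map_rel' := isEmptyElim }
    exact ⟨B, iB, hB, f.comp π, hf⟩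

/-- Structures separated by iterated ultraproducts of a common structure jointly embed. -/
theorem SeparatedBy.jointEmbed [L.IsAlgebraic] {K : StructClass L} (hK : IsQuasivariety K)
    {A : Type u} [iA : L.Structure A] (hA : K A iA) {M N : Type u} [L.Structure M]
    [L.Structure N] [hM : Nontrivial M] [hN : Nontrivial N] (hMA : SeparatedBy L A M)
    (hNA : SeparatedBy L A N) : JointEmbed K M N := by
  obtain ⟨B, iB, f, hB, hf⟩ := hMA.exists_family
  obtain ⟨B', iB', g, hB', hg⟩ := hNA.exists_family
  obtain ⟨m, m', hm⟩ := hM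
  obtain ⟨n, n', hn⟩ := hN
  choose D iD hD e e' using fun ij : {p : M × M // p.1 ≠ p.2} × {p : N × N // p.1 ≠ p.2} =>
    (hB ij.1).jointEmbed hK hA (hB' ij.2)
  let := piStructure (L := L) D
  refine ⟨∀ ij, D ij, inferInstance, hK.prod_closed _ D hD,
    ⟨Embedding.ofInjective (f := homPi fun ij => (e ij).some.toHom.comp (f ij.1)) ?_⟩,
    ⟨Embedding.ofInjective (f := homPi fun ij => (e' ij).some.toHom.comp (g ij.2)) ?_⟩⟩
  · intro a b h
    by_contra hab
    exact hf ⟨(a, b), hab⟩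
      ((e (⟨(a, b), hab⟩, ⟨(n, n'), hn⟩)).some.injective (congrFun h _))
  · intro a b h
    by_contra hab
    exact hg ⟨(a, b), hab⟩
      ((e' (⟨(m, m'), hm⟩, ⟨(a, b), hab⟩)).some.injective (congrFun h _))

/-- in an algebraic variety with EDPC, the variety generated by
any simple member has the JEP; indeed it coincides with the generated
quasivariety. -/
theorem statement_10 (L : FirstOrder.Language.{u, u}) (halg : L.IsAlgebraic)
    (K : StructClass L) (hK : IsVariety K) (hedpc : HasEDPC K)
    (A : Type u) [iA : L.Structure A] (hA : K A iA)
    (hsimple : IsSimpleAlg L A) :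
    HasJEP (VGen (@ClassOf L A iA)) ∧ EqClass (VGen (@ClassOf L A iA)) (QGen (@ClassOf L A iA)) := by
  have := halg
  have hsep : ∀ (M : Type u) [iM : L.Structure M], VGen (L := L) (ClassOf A) M iM →
      SeparatedBy L A M :=
    fun M iM hM =>
      have hvar := isVariety_separatedBy hK hedpc hA hsimple
      (hM _ hvar (ClassOf.subClass hvar.iso_closed
        ⟨hA, fun a b hab => ⟨A, iA, .base, Hom.id L A, hab⟩⟩)).2
  have hQ := qGen_isQuasivariety (L := L) (ClassOf A)
  have hAQ : QGen (ClassOf A) A iA := subClass_qGen _ A iA (classOf_self A)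
  refine ⟨fun M iM N iN hM hN _ _ => ?_, fun M iM => ⟨fun hM => ?_, qGen_subClass_vGen _ M iM⟩⟩
  · obtain ⟨D, iD, hD, h⟩ := (hsep M hM).jointEmbed hQ hAQ (hsep N hN)
    exact ⟨D, iD, qGen_subClass_vGen _ D iD hD, h⟩
  · exact (hsep M hM).mem hQ hAQ

end Paper
end

section
/- An algebraic quasivariety K has the joint embedding property if and only if K respects the relevance principle: whenever Γ ∪ Δ ∪ {φ ≈ ψ} is a finite set of equations with Var(Δ) ∩ Var(Γ ∪ {φ ≈ ψ}) = ∅, and Δ is consistent over K (i.e., there exist terms α, β with K ⊭ (& Δ) ⟹ α ≈ β), then K ⊨ (& (Γ ∪ Δ)) ⟹ φ ≈ ψ implies K ⊨ (& Γ) ⟹ φ ≈ ψ. -/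
universe u

open FirstOrder Language Structure

namespace Paper

variable {L : FirstOrder.Language.{u, u}}

/-- `K` respects the relevance principle. -/
def RespectsRelevance (K : StructClass L) : Prop :=
  ∀ (Γ Δ : Set (L.Term ℕ × L.Term ℕ)) (φ ψ : L.Term ℕ),
    Γ.Finite → Δ.Finite →
    Disjoint (EqnsVars Δ) (EqnsVars (Γ ∪ {(φ, ψ)})) →
    (∃ α β : L.Term ℕ, ¬ QEqValid K Δ α β) →
    QEqValid K (Γ ∪ Δ) φ ψ → QEqValid K Γ φ ψ

theorem realize_eq_of_eqOn_varFinset {M : Type*} [L.Structure M] {α : Type*} [DecidableEq α]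
    {v w : α → M} (t : L.Term α) (h : ∀ i ∈ t.varFinset, v i = w i) :
    t.realize v = t.realize w := by
  rw [← Term.realize_restrictVar' (s := ↑t.varFinset) subset_rfl (v := v),
    ← Term.realize_restrictVar' (s := ↑t.varFinset) subset_rfl (v := w)]
  congr 1
  exact funext fun i => h i i.2

theorem realize_eq_of_eqOn_eqnsVars {M : Type*} [L.Structure M]
    {Γ : Set (L.Term ℕ × L.Term ℕ)} {v w : ℕ → M} (h : ∀ i ∈ EqnsVars Γ, v i = w i)
    {p : L.Term ℕ × L.Term ℕ} (hp : p ∈ Γ) :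
    p.1.realize v = p.1.realize w ∧ p.2.realize v = p.2.realize w := by
  have hsub : ∀ i ∈ p.1.varFinset ∪ p.2.varFinset, v i = w i := fun i hi =>
    h i (Set.mem_biUnion hp hi)
  exact ⟨realize_eq_of_eqOn_varFinset _ fun i hi => hsub i (Finset.mem_union_left _ hi),
    realize_eq_of_eqOn_varFinset _ fun i hi => hsub i (Finset.mem_union_right _ hi)⟩

theorem RespectsRelevance.of_hasJEP {K : StructClass L} (hJEP : HasJEP K) :
    RespectsRelevance K := by
  classical
  rintro Γ Δ φ ψ - - hdisj ⟨α, β, hcons⟩ hval A iA hA w hw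
  by_contra hne
  simp only [QEqValid, not_forall] at hcons
  obtain ⟨B, iB, hB, v, hv, hαβ⟩ := hcons
  obtain ⟨C, iC, hC, ⟨f⟩, ⟨g⟩⟩ := hJEP A B hA hB ⟨_, _, hne⟩ ⟨_, _, hαβ⟩
  let x : ℕ → C := fun i => if i ∈ EqnsVars Δ then g (v i) else f (w i)
  have hxΔ : ∀ i ∈ EqnsVars Δ, x i = (g ∘ v) i := fun i hi => if_pos hi
  have hxΓ : ∀ i ∈ EqnsVars (Γ ∪ {(φ, ψ)}), x i = (f ∘ w) i := fun i hi =>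
    if_neg (Set.disjoint_right.1 hdisj hi)
  have hx := hval C hC x <| by
    rintro p (hp | hp)
    · obtain ⟨h₁, h₂⟩ := realize_eq_of_eqOn_eqnsVars hxΓ (Or.inl hp)
      rw [h₁, h₂, HomClass.realize_term, HomClass.realize_term, hw p hp]
    · obtain ⟨h₁, h₂⟩ := realize_eq_of_eqOn_eqnsVars hxΔ hp
      rw [h₁, h₂, HomClass.realize_term, HomClass.realize_term, hv p hp]
  obtain ⟨h₁, h₂⟩ := realize_eq_of_eqOn_eqnsVars hxΓ (Or.inr rfl)
  rw [h₁, h₂, HomClass.realize_term, HomClass.realize_term] at hx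
  exact hne (f.injective hx)

/-- The entries of the operation tables of `A`: an operation symbol with a tuple of arguments. -/
abbrev TableEntry (L : FirstOrder.Language.{u, u}) (A : Type u) : Type u :=
  Σ n, L.Functions n × (Fin n → A)

/-- The equation recording an operation table entry, with `e a` as the variable naming `a`. -/
def TableEntry.eqn {A : Type u} [L.Structure A] (e : A → ℕ) (d : TableEntry L A) :
    L.Term ℕ × L.Term ℕ :=
  (Term.func d.2.1 fun j => Term.var (e (d.2.2 j)), Term.var (e (funMap d.2.1 d.2.2)))

theorem TableEntry.eqn_realize_iff {A M : Type u} [L.Structure A] [L.Structure M] (e : A → ℕ)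
    (d : TableEntry L A) (v : ℕ → M) :
    (d.eqn e).1.realize v = (d.eqn e).2.realize v ↔
      funMap d.2.1 (fun j => v (e (d.2.2 j))) = v (e (funMap d.2.1 d.2.2)) :=
  Iff.rfl

theorem TableEntry.eqnsVars_eqn_subset {A : Type u} [L.Structure A] (e : A → ℕ)
    (F : Set (TableEntry L A)) : EqnsVars (TableEntry.eqn e '' F) ⊆ Set.range e := by
  intro i hi
  simp only [EqnsVars, Set.mem_iUnion, Set.mem_image] at hi
  obtain ⟨-, ⟨d, -, rfl⟩, hi⟩ := hi
  simp only [TableEntry.eqn, Term.varFinset, Finset.coe_union, Set.mem_union, Finset.mem_coe,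
    Finset.mem_biUnion, Finset.mem_univ, true_and, Finset.mem_singleton] at hi
  rcases hi with ⟨j, rfl⟩ | rfl <;> exact Set.mem_range_self _

/-- Finitely many table entries and two elements can be named by variables from any infinite
supply, so that some valuation interprets the names correctly. -/
theorem TableEntry.exists_naming {A : Type u} [L.Structure A] (F : Finset (TableEntry L A))
    (a a' : A) {c : ℕ → ℕ} (hc : Function.Injective c) :
    ∃ (e : A → ℕ) (r : ℕ → A), Set.range e ⊆ Set.range c ∧ r (e a) = a ∧ r (e a') = a' ∧
      ∀ p ∈ TableEntry.eqn e '' (F : Set (TableEntry L A)),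
        Term.realize r p.1 = Term.realize r p.2 := by
  let S : Set A := {a, a'} ∪
    ⋃ d ∈ F, Set.range d.2.2 ∪ {funMap d.2.1 d.2.2}
  have hS : S.Finite := (Set.toFinite _).union <|
    F.finite_toSet.biUnion fun d _ => (Set.finite_range _).union (Set.finite_singleton _)
  obtain ⟨e, he⟩ := Set.countable_iff_exists_injOn.1 hS.countable
  have : Nonempty A := ⟨a⟩
  have hr : ∀ x ∈ S, Function.invFunOn (c ∘ e) S ((c ∘ e) x) = x := fun x hx =>
    (hc.comp_injOn he).leftInvOn_invFunOn hx
  refine ⟨c ∘ e, Function.invFunOn (c ∘ e) S, Set.range_comp_subset_range _ _,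
    hr _ (by simp [S]), hr _ (by simp [S]), ?_⟩
  rintro - ⟨d, hd, rfl⟩
  rw [TableEntry.eqn_realize_iff, hr _ (Or.inr (Set.mem_biUnion hd (Or.inr rfl)))]
  congr 1
  exact funext fun j => hr _ (Or.inr (Set.mem_biUnion hd (Or.inl ⟨j, rfl⟩)))

/-- Under the relevance principle, finite parts of the operation tables of two nontrivial members
can be realized in a common member, keeping a given pair of elements apart. -/
theorem RespectsRelevance.exists_partial_homs {K : StructClass L} (hR : RespectsRelevance K)
    {A B : Type u} [iA : L.Structure A] [iB : L.Structure B] (hA : K A iA) (hB : K B iB)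
    [Nontrivial B] {a a' : A} (hne : a ≠ a')
    (F : Finset (TableEntry L A)) (G : Finset (TableEntry L B)) :
    ∃ (C : Type u) (iC : L.Structure C) (h : A → C) (g : B → C), K C iC ∧ h a ≠ h a' ∧
      (∀ d ∈ F, funMap d.2.1 (fun j => h (d.2.2 j)) = h (funMap d.2.1 d.2.2)) ∧
      ∀ d ∈ G, funMap d.2.1 (fun j => g (d.2.2 j)) = g (funMap d.2.1 d.2.2) := by
  obtain ⟨b, b', hb⟩ := exists_pair_ne B
  obtain ⟨e, r, he, hra, hra', hr⟩ := TableEntry.exists_naming F a a'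
    (c := fun n => 2 * n) fun m n h => by simpa using h
  obtain ⟨k, s, hk, hsb, hsb', hs⟩ := TableEntry.exists_naming G b b'
    (c := fun n => 2 * n + 1) fun m n h => by simpa using h
  have hdisj : Disjoint (Set.range k) (Set.range e) := by
    refine Set.disjoint_of_subset hk he (Set.disjoint_left.2 ?_)
    rintro - ⟨m, rfl⟩ ⟨n, hn⟩
    dsimp only at hn
    omega
  have hval : ¬ QEqValid K (TableEntry.eqn e '' F ∪ TableEntry.eqn k '' G)
      (Term.var (e a)) (Term.var (e a')) := by
    intro hval
    have := hR _ _ _ _ (F.finite_toSet.image _) (G.finite_toSet.image _) ?_ ?_ hval A hA r hr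
    · simp only [Term.realize_var, hra, hra'] at this
      exact hne this
    · refine Set.disjoint_of_subset (TableEntry.eqnsVars_eqn_subset k _) ?_ hdisj
      intro i hi
      simp only [EqnsVars, Set.biUnion_union, Set.biUnion_singleton] at hi
      rcases hi with hi | hi
      · exact TableEntry.eqnsVars_eqn_subset e _ hi
      · simp only [Term.varFinset, Finset.coe_union, Finset.coe_singleton] at hi
        rcases hi with rfl | rfl <;> exact Set.mem_range_self _
    · refine ⟨Term.var (k b), Term.var (k b'), fun h => hb ?_⟩
      simpa only [Term.realize_var, hsb, hsb'] using h B hB s hs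
  simp only [QEqValid, not_forall] at hval
  obtain ⟨C, iC, hC, v, hv, hvne⟩ := hval
  exact ⟨C, iC, v ∘ e, v ∘ k, hC, hvne,
    fun d hd => (TableEntry.eqn_realize_iff e d v).1 (hv _ (Or.inl ⟨d, hd, rfl⟩)),
    fun d hd => (TableEntry.eqn_realize_iff k d v).1 (hv _ (Or.inr ⟨d, hd, rfl⟩))⟩

/-- Maps into the factors of an ultraproduct that eventually respect each table entry induce a
homomorphism. -/
def ultraproductHom [L.IsAlgebraic] {ι A : Type u} [L.Structure A] (uf : Ultrafilter ι)
    {C : ι → Type u} [∀ i, L.Structure (C i)] (h : ∀ i, A → C i)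
    (hh : ∀ d : TableEntry L A, ∀ᶠ i in uf,
      funMap d.2.1 (fun j => h i (d.2.2 j)) = h i (funMap d.2.1 d.2.2)) :
    A →[L] (uf : Filter ι).Product C where
  toFun a := ((fun i => h i a : ∀ i, C i) : (uf : Filter ι).Product C)
  map_fun' {n} f x := by
    refine Eq.trans ?_ (Ultraproduct.funMap_cast f fun j i => h i (x j)).symm
    refine Quotient.sound ?_
    filter_upwards [hh ⟨n, f, x⟩] with i hi using hi.symm
  map_rel' r := isEmptyElim r

theorem RespectsRelevance.exists_homs [L.IsAlgebraic] {K : StructClass L}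
    (hK : IsQuasivariety K) (hR : RespectsRelevance K)
    {A B : Type u} [iA : L.Structure A] [iB : L.Structure B] (hA : K A iA) (hB : K B iB)
    [Nontrivial B] {a a' : A} (hne : a ≠ a') :
    ∃ (C : Type u) (iC : L.Structure C) (h : A →[L] C) (_ : B →[L] C), K C iC ∧ h a ≠ h a' := by
  classical
  choose C iC h g hC hsep hh hg using fun i : Finset (TableEntry L A) × Finset (TableEntry L B) =>
    hR.exists_partial_homs hA hB hne i.1 i.2
  let uf : Ultrafilter (Finset (TableEntry L A) × Finset (TableEntry L B)) :=
    Ultrafilter.of Filter.atTop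
  have hle : uf.toFilter ≤ Filter.atTop := Ultrafilter.of_le _
  refine ⟨(uf : Filter _).Product C, inferInstance,
    ultraproductHom uf h fun d => ?_, ultraproductHom uf g fun d => ?_,
    hK.ultra_closed _ C uf hC, fun heq => ?_⟩
  · filter_upwards [hle (Filter.eventually_ge_atTop ({d}, ∅))] with i hi
    exact hh i d (hi.1 (Finset.mem_singleton_self d))
  · filter_upwards [hle (Filter.eventually_ge_atTop (∅, {d}))] with i hi
    exact hg i d (hi.2 (Finset.mem_singleton_self d))
  · have hev : ∀ᶠ i in (uf : Filter _), h i a = h i a' := Quotient.exact heq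
    obtain ⟨i, hi⟩ := hev.exists
    exact hsep i hi

/-- The homomorphism into a product induced by homomorphisms into the factors. -/
def piHom [L.IsAlgebraic] {ι A : Type u} [iA : L.Structure A] {C : ι → Type u}
    [∀ i, L.Structure (C i)] (h : ∀ i, A →[L] C i) :
    @FirstOrder.Language.Hom L A (∀ i, C i) iA (piStructure C) :=
  letI := piStructure (L := L) C
  { toFun := fun a i => h i a
    map_fun' := fun f x => funext fun i => (h i).map_fun f x
    map_rel' := fun r => isEmptyElim r }

theorem HasJEP.of_respectsRelevance [L.IsAlgebraic] {K : StructClass L}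
    (hK : IsQuasivariety K) (hR : RespectsRelevance K) : HasJEP K := by
  intro A iA B iB hA hB _ _
  have key : ∀ i : {p : A × A // p.1 ≠ p.2} ⊕ {p : B × B // p.1 ≠ p.2},
      ∃ (C : Type u) (iC : L.Structure C) (h : A →[L] C) (g : B →[L] C), K C iC ∧
        (∀ p, i = Sum.inl p → h p.1.1 ≠ h p.1.2) ∧ ∀ p, i = Sum.inr p → g p.1.1 ≠ g p.1.2 := by
    rintro (p | p)
    · obtain ⟨C, iC, h, g, hC, hp⟩ := hR.exists_homs hK hA hB p.2
      exact ⟨C, iC, h, g, hC, by rintro _ ⟨⟩; exact hp, by rintro _ ⟨⟩⟩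
    · obtain ⟨C, iC, g, h, hC, hp⟩ := hR.exists_homs hK hB hA p.2
      exact ⟨C, iC, h, g, hC, by rintro _ ⟨⟩, by rintro _ ⟨⟩; exact hp⟩
  choose C iC h g hC hl hr using key
  let _ := piStructure (L := L) C
  refine ⟨∀ i, C i, piStructure C, hK.prod_closed _ C hC,
    ⟨Embedding.ofInjective (f := piHom h) fun a a' haa => ?_⟩,
    ⟨Embedding.ofInjective (f := piHom g) fun b b' hbb => ?_⟩⟩
  · by_contra hne
    exact hl (Sum.inl ⟨(a, a'), hne⟩) _ rfl (congrFun haa _)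
  · by_contra hne
    exact hr (Sum.inr ⟨(b, b'), hne⟩) _ rfl (congrFun hbb _)

/-- an algebraic quasivariety has the JEP iff it respects the
relevance principle. -/
theorem statement_11 (L : FirstOrder.Language.{u, u}) (halg : L.IsAlgebraic)
    (K : StructClass L) (hK : IsQuasivariety K) :
    HasJEP K ↔ RespectsRelevance K := by
  exact ⟨RespectsRelevance.of_hasJEP, HasJEP.of_respectsRelevance hK⟩

end Paper
end

section
/- A relatively semisimple algebraic quasivariety K is passively structurally complete if and only if K is a minimal quasivariety or no quasi-equation is passive over K. -/
universe u

open FirstOrder Language Structure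

namespace Paper

variable {L : FirstOrder.Language.{u, u}}

/-- A map commuting with all operations, as a homomorphism of algebras. -/
def homOfIsAlgebraic (halg : L.IsAlgebraic) {M N : Type u} [L.Structure M] [L.Structure N]
    (g : M → N)
    (hg : ∀ (n : ℕ) (f : L.Functions n) (x : Fin n → M), g (funMap f x) = funMap f (g ∘ x)) :
    M →[L] N where
  toFun := g
  map_fun' := fun f x => hg _ f x
  map_rel' := fun r _ _ => (halg _).elim r

/-- The coordinate projection of a direct product. -/
def piProj {ι : Type u} (M : ι → Type u) [∀ i, L.Structure (M i)] (i : ι) :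
    @FirstOrder.Language.Hom L (∀ i, M i) (M i) (piStructure M) _ :=
  letI := piStructure (L := L) M
  { toFun := fun x => x i
    map_fun' := fun _ _ => rfl
    map_rel' := fun _ _ h => h i }

theorem IsEP.realize_hom {M N : Type u} [L.Structure M] [L.Structure N] (g : M →[L] N) {n : ℕ}
    {φ : L.BoundedFormula Empty n} (hφ : IsEP φ) (v : Empty → M) (xs : Fin n → M)
    (h : φ.Realize v xs) : φ.Realize (g ∘ v) (g ∘ xs) := by
  induction hφ with
  | equal t₁ t₂ =>
    rw [BoundedFormula.realize_bdEqual] at h ⊢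
    rw [← Sum.comp_elim, HomClass.realize_term, HomClass.realize_term, h]
  | rel R ts =>
    simp only [BoundedFormula.Realize, ← Sum.comp_elim, HomClass.realize_term] at h ⊢
    exact g.map_rel R _ h
  | sup _ _ ih₁ ih₂ =>
    rw [BoundedFormula.realize_sup] at h ⊢
    exact h.imp (ih₁ xs) (ih₂ xs)
  | inf _ _ ih₁ ih₂ =>
    rw [BoundedFormula.realize_inf] at h ⊢
    exact h.imp (ih₁ xs) (ih₂ xs)
  | ex _ ih =>
    rw [BoundedFormula.realize_ex] at h ⊢
    obtain ⟨a, ha⟩ := h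
    refine ⟨g a, ?_⟩
    rw [← Fin.comp_snoc]
    exact ih _ ha

theorem IsEP.sentence_realize_hom {M N : Type u} [L.Structure M] [L.Structure N] (g : M →[L] N)
    {φ : L.Sentence} (hφ : IsEP φ) (h : M ⊨ φ) : N ⊨ φ := by
  have := hφ.realize_hom g _ _ h
  rwa [Subsingleton.elim (g ∘ (default : Empty → M)) default,
    Subsingleton.elim (g ∘ (default : Fin 0 → M)) default] at this

theorem IsEP.exs : ∀ {n : ℕ} {φ : L.BoundedFormula Empty n}, IsEP φ → IsEP φ.exs
  | 0, _, h => h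
  | _ + 1, φ, h => IsEP.exs (φ := φ.ex) (IsEP.ex h)

/-- Satisfiability of a finite system of equations is expressed by an existential positive
sentence. -/
theorem exists_isEP_of_finite {n : ℕ} {Γ : Set (L.Term (Fin (n + 1)) × L.Term (Fin (n + 1)))}
    (hΓ : Γ.Finite) :
    ∃ φ : L.Sentence, IsEP φ ∧ ∀ (M : Type u) [L.Structure M],
      M ⊨ φ ↔ ∃ w : Fin (n + 1) → M, ∀ p ∈ Γ, p.1.realize w = p.2.realize w := by
  have key : ∃ ψ : L.BoundedFormula Empty (n + 1), IsEP ψ ∧ ∀ (M : Type u) [L.Structure M]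
      (w : Fin (n + 1) → M), ψ.Realize default w ↔ ∀ p ∈ Γ, p.1.realize w = p.2.realize w := by
    induction Γ, hΓ using Set.Finite.induction_on with
    | empty =>
      refine ⟨_, IsEP.equal (Term.var (Sum.inr 0)) (Term.var (Sum.inr 0)), fun M _ w => ?_⟩
      simp [BoundedFormula.realize_bdEqual]
    | @insert p Γ _ _ ih =>
      obtain ⟨ψ, hψ, hr⟩ := ih
      refine ⟨_, IsEP.inf (IsEP.equal (p.1.relabel Sum.inr) (p.2.relabel Sum.inr)) hψ,
        fun M _ w => ?_⟩
      rw [BoundedFormula.realize_inf, hr, BoundedFormula.realize_bdEqual, Set.forall_mem_insert,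
        Term.realize_relabel, Term.realize_relabel, Sum.elim_comp_inr]
  obtain ⟨ψ, hψ, hr⟩ := key
  refine ⟨ψ.exs, hψ.exs, fun M _ => ?_⟩
  rw [Sentence.Realize, BoundedFormula.realize_exs]
  exact exists_congr fun w => hr M w

/-- Over algebras, an existential positive formula is implied, at constant assignments, by a finite
set of equations in one variable. -/
theorem IsEP.exists_finite_equations (halg : L.IsAlgebraic) {n : ℕ}
    {φ : L.BoundedFormula Empty n} (hφ : IsEP φ) :
    ∃ Γ : Set (L.Term ℕ × L.Term ℕ), Γ.Finite ∧ ∀ (M : Type u) [L.Structure M] (b : M),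
      (∀ p ∈ Γ, p.1.realize (fun _ => b) = p.2.realize fun _ => b) →
      φ.Realize default fun _ => b := by
  induction hφ with
  | equal t₁ t₂ =>
    refine ⟨{(t₁.relabel fun _ => 0, t₂.relabel fun _ => 0)}, Set.finite_singleton _,
      fun M _ b h => ?_⟩
    have h := h _ rfl
    simp only [Term.realize_relabel] at h
    rw [BoundedFormula.realize_bdEqual]
    convert h using 2 <;>
    · funext x
      rcases x with x | x
      · exact x.elim
      · rfl
  | rel R => exact (halg _).elim R
  | sup _ _ ih₁ _ =>
    obtain ⟨Γ, hΓ, h⟩ := ih₁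
    exact ⟨Γ, hΓ, fun M _ b hb => BoundedFormula.realize_sup.2 (Or.inl (h M b hb))⟩
  | inf _ _ ih₁ ih₂ =>
    obtain ⟨Γ₁, hΓ₁, h₁⟩ := ih₁
    obtain ⟨Γ₂, hΓ₂, h₂⟩ := ih₂
    exact ⟨Γ₁ ∪ Γ₂, hΓ₁.union hΓ₂, fun M _ b hb => BoundedFormula.realize_inf.2
      ⟨h₁ M b fun p hp => hb p (Or.inl hp), h₂ M b fun p hp => hb p (Or.inr hp)⟩⟩
  | ex _ ih =>
    obtain ⟨Γ, hΓ, h⟩ := ih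
    refine ⟨Γ, hΓ, fun M _ b hb => BoundedFormula.realize_ex.2 ⟨b, ?_⟩⟩
    convert h M b hb using 1
    funext i
    refine Fin.lastCases ?_ (fun j => ?_) i <;> simp

theorem isPSC_of_noPassiveQEq (halg : L.IsAlgebraic) {K : StructClass L} (h : NoPassiveQEq K) :
    IsPSC K := by
  intro A iA B iB _ hB _ _ φ hφ _
  obtain ⟨Γ, hΓ, hΓφ⟩ := hφ.exists_finite_equations halg
  let r : L.Term ℕ × L.Term ℕ → L.Term ℕ × L.Term ℕ := fun p =>
    (p.1.relabel fun _ => 0, p.2.relabel fun _ => 0)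
  obtain ⟨s, hs⟩ := h (r '' Γ) (hΓ.image r)
  obtain ⟨b⟩ : Nonempty B := inferInstance
  have := hΓφ B ((s 0).realize fun _ => b) fun p hp => by
    have := hs _ (Set.mem_image_of_mem r hp) B hB fun _ => b
    simp only [r, Term.realize_subst, Term.realize_relabel] at this
    exact this
  rwa [Subsingleton.elim (fun _ => _ : Fin 0 → B) default] at this

theorem isPSC_of_minimalQV {K : StructClass L} (hK : IsQuasivariety K) (h : MinimalQV K) :
    IsPSC K := by
  intro A iA B iB hA hB hnA hnB φ hφ hAφ
  by_contra hBφ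
  let K' : StructClass L := fun M iM => K M iM ∧ (Subsingleton M ∨ ¬ M ⊨ φ)
  have sub : ∀ (M : Type u) [iM : L.Structure M] (N : Type u) [iN : L.Structure N],
      Nonempty (M ↪[L] N) → K' N iN → K' M iM := by
    rintro M iM N iN ⟨g⟩ ⟨hN, hN'⟩
    refine ⟨hK.sub_closed M N ⟨g⟩ hN, hN'.imp (fun h => @Function.Injective.subsingleton _ _ _ g.injective h) ?_⟩
    exact fun hn hM => hn (hφ.sentence_realize_hom g.toHom hM)
  have hK' : IsQuasivariety K' :=
    { iso_closed := fun M _ N _ ⟨e⟩ hM => sub N M ⟨e.symm.toEmbedding⟩ hM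
      sub_closed := sub
      prod_closed := by
        intro ι M iM hM
        refine ⟨hK.prod_closed ι M fun i => (hM i).1, ?_⟩
        let := piStructure (L := L) M
        by_cases hi : ∃ i, ¬ M i ⊨ φ
        · obtain ⟨i, hi⟩ := hi
          exact Or.inr fun hp => hi (hφ.sentence_realize_hom (piProj M i) hp)
        · have : ∀ i, Subsingleton (M i) := fun i =>
            (hM i).2.resolve_right fun hn => hi ⟨i, hn⟩
          exact Or.inl inferInstance
      ultra_closed := by
        intro ι M iM uf hM
        refine ⟨hK.ultra_closed ι M uf fun i => (hM i).1, ?_⟩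
        by_cases hne : ∀ i, Nonempty (M i)
        · by_cases hi : ∀ᶠ i in (uf : Filter ι), ¬ M i ⊨ φ
          · refine Or.inr fun hp => ?_
            rw [Ultraproduct.sentence_realize] at hp
            obtain ⟨i, h₁, h₂⟩ := (hi.and hp).exists
            exact h₁ h₂
          · refine Or.inl ⟨fun x y => ?_⟩
            rw [Ultrafilter.eventually_not, not_not] at hi
            induction x using Quotient.inductionOn with | _ x
            induction y using Quotient.inductionOn with | _ y
            refine Quotient.sound (hi.mono fun i hi => ?_)
            have := (hM i).2.resolve_right (not_not.2 hi)
            exact Subsingleton.elim _ _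
        · refine Or.inl ⟨fun x y => (hne fun i => ?_).elim⟩
          induction x using Quotient.inductionOn with | _ x
          exact ⟨x i⟩ }
  have := ((h.2 K' hK' (fun _ _ hM => hM.1) ⟨B, iB, ⟨hB, Or.inr hBφ⟩, hnB⟩) A iA).2 hA
  exact this.2.elim (not_subsingleton A) fun hn => hn hAφ

/-- A family of maps each of whose homomorphism conditions holds eventually induces a homomorphism
into the ultraproduct. -/
theorem exists_hom_ultraproduct (halg : L.IsAlgebraic) {M : Type u} [L.Structure M] {ι : Type u}
    (uf : Ultrafilter ι) (N : ι → Type u) [∀ i, L.Structure (N i)] (g : ∀ i, M → N i)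
    (hg : ∀ (n : ℕ) (f : L.Functions n) (x : Fin n → M),
      ∀ᶠ i in (uf : Filter ι), g i (funMap f x) = funMap f (g i ∘ x)) :
    ∃ h : M →[L] (uf : Filter ι).Product N,
      ∀ x y, h x = h y ↔ ∀ᶠ i in (uf : Filter ι), g i x = g i y := by
  refine ⟨homOfIsAlgebraic halg
    (fun x => ((fun i => g i x : ∀ i, N i) : (uf : Filter ι).Product N)) fun n f x => ?_,
    fun x y => ?_⟩
  · refine Eq.trans ?_ (Ultraproduct.funMap_cast f fun j i => g i (x j)).symm
    exact Quotient.sound (hg n f x)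
  · exact Quotient.eq''

theorem IsQuasivariety.mem_of_separated (halg : L.IsAlgebraic) {K : StructClass L}
    (hK : IsQuasivariety K) {A : Type u} [iA : L.Structure A]
    (h : ∀ a b : A, a ≠ b → ∃ (N : Type u) (iN : L.Structure N), K N iN ∧
      ∃ g : A →[L] N, g a ≠ g b) : K A iA := by
  choose N iN hN g hg using fun p : {p : A × A // p.1 ≠ p.2} => h p.1.1 p.1.2 p.2
  let := piStructure (L := L) N
  let e : A →[L] (∀ p, N p) := homOfIsAlgebraic halg (fun a p => g p a) fun n f x => by
    funext p
    exact (g p).map_fun f x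
  have he : Function.Injective e := fun a b hab => by
    by_contra hne
    exact hg ⟨(a, b), hne⟩ (congrFun hab ⟨(a, b), hne⟩)
  exact hK.sub_closed A _ ⟨Embedding.ofInjective he⟩ (hK.prod_closed _ N hN)

/-- A member of `K` maps onto a relatively subdirectly irreducible member separating two given
distinct points. -/
theorem IsQuasivariety.exists_relSDI (halg : L.IsAlgebraic) {K : StructClass L}
    (hK : IsQuasivariety K) {A : Type u} [iA : L.Structure A] (hA : K A iA) {a b : A}
    (hab : a ≠ b) :
    ∃ (N : Type u) (iN : L.Structure N), K N iN ∧ RelSDI K N ∧ ∃ g : A →[L] N, g a ≠ g b := by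
  let S : Set (Setoid A) := {θ | (∃ (N : Type u) (iN : L.Structure N), K N iN ∧
      ∃ g : A →[L] N, ∀ x y, θ.r x y ↔ g x = g y) ∧ ¬ θ.r a b}
  have hbot : (⊥ : Setoid A) ∈ S := ⟨⟨A, iA, hA, Hom.id L A, fun _ _ => Iff.rfl⟩, hab⟩
  obtain ⟨θ, -, hθ⟩ := zorn_le_nonempty₀ S (fun c hc hchain y hy => by
    choose N iN hN g hg using fun i : c => (hc i.2).1
    have : Nonempty c := ⟨⟨y, hy⟩⟩
    have : IsDirectedOrder c := ⟨fun i j => by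
      rcases hchain.total i.2 j.2 with h | h
      · exact ⟨j, h, le_rfl⟩
      · exact ⟨i, le_rfl, h⟩⟩
    let uf : Ultrafilter c := Ultrafilter.of Filter.atTop
    have hev : ∀ (i : c) (p : c → Prop), (∀ j, i ≤ j → p j) → ∀ᶠ j in (uf : Filter c), p j :=
      fun i p hp => Filter.Eventually.filter_mono (Ultrafilter.of_le _)
        ((Filter.eventually_ge_atTop i).mono hp)
    obtain ⟨h, hh⟩ := exists_hom_ultraproduct halg uf N (fun i => g i) fun n f x =>
      Filter.Eventually.of_forall fun i => (g i).map_fun f x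
    refine ⟨Setoid.ker h, ⟨⟨_, _, hK.ultra_closed c N uf hN, h, fun _ _ => Iff.rfl⟩, fun hr => ?_⟩,
      fun z hz x y hxy => ?_⟩
    · obtain ⟨i, hi⟩ := ((hh a b).1 hr).exists
      exact (hc i.2).2 ((hg i a b).2 hi)
    · exact (hh x y).2 (hev ⟨z, hz⟩ _ fun j hj => (hg j x y).1 (hj hxy))) ⊥ hbot
  obtain ⟨⟨N, iN, hN, g, hg⟩, hθab⟩ := hθ.1
  have hR : K g.range inferInstance := hK.sub_closed _ _ ⟨g.range.subtype⟩ hN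
  let g' : A →[L] g.range := Hom.codRestrict g.range g g.mem_range_self
  have hsurj : Function.Surjective g' := by
    rintro ⟨_, x, rfl⟩
    exact ⟨x, rfl⟩
  have hg' : ∀ x y, θ.r x y ↔ g' x = g' y := fun x y => (hg x y).trans
    (Subtype.ext_iff (a1 := g' x) (a2 := g' y)).symm
  have hne : g' a ≠ g' b := fun h => hθab ((hg' a b).2 h)
  refine ⟨g.range, inferInstance, hR, ⟨hR, ?_⟩, g', hne⟩
  intro ι M iM hM e hes
  let := piStructure (L := L) M
  obtain ⟨i, hi⟩ : ∃ i, e (g' a) i ≠ e (g' b) i := by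
    by_contra! hcon
    exact hne (e.injective (funext hcon))
  refine ⟨i, fun x y hxy => ?_, hes i⟩
  let q : A →[L] M i := ((piProj M i).comp e.toHom).comp g'
  have hq : Setoid.ker q ∈ S := ⟨⟨M i, iM i, hM i, q, fun _ _ => Iff.rfl⟩, hi⟩
  have hle : θ ≤ Setoid.ker q := fun x y h => by
    change e (g' x) i = e (g' y) i
    rw [(hg' x y).1 h]
  obtain ⟨x, rfl⟩ := hsurj x
  obtain ⟨y, rfl⟩ := hsurj y
  exact (hg' x y).1 (hθ.2 hq hle hxy)

/-- If every existential positive sentence true in `A` is true in `B`, then `A` maps into an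
ultrapower of `B`. -/
theorem mapsIntoUltrapower_of_isEP (halg : L.IsAlgebraic) {A B : Type u} [L.Structure A]
    [L.Structure B] [Nonempty A] (h : ∀ φ : L.Sentence, IsEP φ → A ⊨ φ → B ⊨ φ) :
    MapsIntoUltrapower L A B := by
  classical
  let D := Σ n, L.Functions n × (Fin n → A)
  have hfin : ∀ s : Finset D, ∃ w : A → B, ∀ d ∈ s,
      w (funMap d.2.1 d.2.2) = funMap d.2.1 (w ∘ d.2.2) := by
    intro s
    obtain ⟨a₀⟩ := ‹Nonempty A›
    let V : Finset A := insert a₀ (s.biUnion fun d =>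
      insert (funMap d.2.1 d.2.2) (Finset.univ.image d.2.2))
    obtain ⟨n, hn⟩ : ∃ n, V.card = n + 1 :=
      Nat.exists_eq_succ_of_ne_zero (Finset.card_ne_zero_of_mem (Finset.mem_insert_self _ _))
    let e : Fin (n + 1) ≃ V := (V.equivFinOfCardEq hn).symm
    let r : A → Fin (n + 1) := fun a => if ha : a ∈ V then e.symm ⟨a, ha⟩ else 0
    have her : ∀ a ∈ V, (e (r a) : A) = a := fun a ha => by simp [r, ha]
    let eqn : D → L.Term (Fin (n + 1)) × L.Term (Fin (n + 1)) := fun d =>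
      (Term.var (r (funMap d.2.1 d.2.2)), Term.func d.2.1 fun j => Term.var (r (d.2.2 j)))
    obtain ⟨φ, hφ, hr⟩ := exists_isEP_of_finite (L := L) (s.finite_toSet.image eqn)
    obtain ⟨w, hw⟩ := (hr B).1 (h φ hφ ((hr A).2 ⟨fun i => (e i : A), by
      rintro _ ⟨d, hd, rfl⟩
      have hV : ∀ a ∈ insert (funMap d.2.1 d.2.2) (Finset.univ.image d.2.2), a ∈ V := fun a ha =>
        Finset.mem_insert_of_mem (Finset.mem_biUnion.2 ⟨d, hd, ha⟩)
      simp only [eqn, Term.realize_var, Term.realize_func]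
      rw [her _ (hV _ (Finset.mem_insert_self _ _))]
      congr 1
      funext j
      exact (her _ (hV _ (Finset.mem_insert_of_mem
        (Finset.mem_image_of_mem _ (Finset.mem_univ j))))).symm⟩))
    exact ⟨w ∘ r, fun d hd => hw _ ⟨d, hd, rfl⟩⟩
  choose w hw using hfin
  let uf : Ultrafilter (Finset D) := Ultrafilter.of Filter.atTop
  obtain ⟨g, -⟩ := exists_hom_ultraproduct halg uf (fun _ => B) w fun n f x =>
    Filter.Eventually.filter_mono (Ultrafilter.of_le _)
      ((Filter.eventually_ge_atTop {(⟨n, f, x⟩ : D)}).mono fun s hs =>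
        hw s ⟨n, f, x⟩ (hs (Finset.mem_singleton_self _)))
  exact ⟨Finset D, uf, ⟨g⟩⟩

/-- `K` has a member generated by a sequence `v` such that every equation holding at `v` is valid
in `K`: a free algebra on countably many generators. -/
theorem IsQuasivariety.exists_free {K : StructClass L} (hK : IsQuasivariety K) :
    ∃ (F : Type u) (iF : L.Structure F) (v : ℕ → F), K F iF ∧
      (∀ x : F, ∃ t : L.Term ℕ, t.realize v = x) ∧
      ∀ s t : L.Term ℕ, s.realize v = t.realize v → EqValid K s t := by
  have h : ∀ p : {p : L.Term ℕ × L.Term ℕ // ¬ EqValid K p.1 p.2},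
      ∃ (M : Type u) (iM : L.Structure M), K M iM ∧
        ∃ v : ℕ → M, p.1.1.realize v ≠ p.1.2.realize v := by
    rintro ⟨p, hp⟩
    simp only [EqValid, not_forall] at hp
    obtain ⟨M, iM, hM, v, hv⟩ := hp
    exact ⟨M, iM, hM, v, hv⟩
  choose M iM hM v hv using h
  let := piStructure (L := L) M
  let g : ℕ → ∀ p, M p := fun n p => v p n
  let F := Substructure.closure L (Set.range g)
  let v' : ℕ → F := fun n => ⟨g n, Substructure.subset_closure ⟨n, rfl⟩⟩
  have hv' : ∀ t : L.Term ℕ, F.subtype (t.realize v') = t.realize g := fun t =>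
    (HomClass.realize_term F.subtype (t := t) (v := v')).symm
  refine ⟨F, inferInstance, v', hK.sub_closed _ _ ⟨F.subtype⟩ (hK.prod_closed _ M hM), ?_, ?_⟩
  · rintro ⟨x, hx⟩
    obtain ⟨t, rfl⟩ := Substructure.mem_closure_iff_exists_term.1 hx
    refine ⟨t.relabel (Set.rangeSplitting g), Subtype.ext ?_⟩
    refine (hv' _).trans ?_
    rw [Term.realize_relabel]
    congr 1
    funext y
    exact Set.apply_rangeSplitting g y
  · intro s t hst
    by_contra hn
    have h₁ : s.realize g = t.realize g := by rw [← hv', ← hv', hst]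
    have h₂ : ∀ r : L.Term ℕ, r.realize (v ⟨(s, t), hn⟩) = r.realize g ⟨(s, t), hn⟩ :=
      fun r => HomClass.realize_term (piProj M ⟨(s, t), hn⟩) (t := r) (v := g)
    exact hv ⟨(s, t), hn⟩ (by rw [h₂, h₂, h₁])

theorem noPassiveQEq_of_isPSC_of_idempotent {K : StructClass L} (hK : IsQuasivariety K)
    (hpsc : IsPSC K) {B : Type u} [iB : L.Structure B] (hB : K B iB) [Nontrivial B]
    (hidem : HasOneElemSub L B) : NoPassiveQEq K := by
  intro Γ hΓ
  obtain ⟨c, hc⟩ := hidem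
  obtain ⟨F, iF, v, hF, hgen, hfree⟩ := hK.exists_free
  have hnF : Nontrivial F := by
    obtain ⟨b₀, b₁, hb⟩ := exists_pair_ne B
    refine ⟨v 0, v 1, fun h => hb ?_⟩
    simpa using hfree (Term.var 0) (Term.var 1) h B hB fun n => if n = 0 then b₀ else b₁
  let r : L.Term ℕ × L.Term ℕ → L.Term (Fin (0 + 1)) × L.Term (Fin (0 + 1)) := fun p =>
    (p.1.relabel fun _ => 0, p.2.relabel fun _ => 0)
  obtain ⟨φ, hφ, hr⟩ := exists_isEP_of_finite (hΓ.image r)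
  have hcon : ∀ t : L.Term (Fin (0 + 1)), t.realize (fun _ => c) = c := by
    intro t
    induction t with
    | var => rfl
    | func f ts ih => simp only [Term.realize_func, ih, hc]
  obtain ⟨w, hw⟩ := (hr F).1 (hpsc B F hB hF inferInstance hnF φ hφ
    ((hr B).2 ⟨fun _ => c, fun p _ => by rw [hcon, hcon]⟩))
  obtain ⟨t, ht⟩ := hgen (w 0)
  refine ⟨fun _ => t, fun p hp => hfree _ _ ?_⟩
  have := hw _ (Set.mem_image_of_mem r hp)
  simp only [r, Term.realize_relabel] at this
  rw [Term.realize_subst, Term.realize_subst, ht]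
  exact this

theorem minimalQV_of_isPSC (halg : L.IsAlgebraic) {K : StructClass L} (hK : IsQuasivariety K)
    (hss : RelSemisimple K) (hpsc : IsPSC K) (hpass : ¬ NoPassiveQEq K) : MinimalQV K := by
  refine ⟨?_, fun K' hK' hsub ⟨B, iB, hB, hnB⟩ A iA => ⟨hsub A iA, fun hA => ?_⟩⟩
  · by_contra htriv
    refine hpass fun Γ _ => ⟨Term.var, fun p _ M iM hM v => ?_⟩
    have : Subsingleton M := not_nontrivial_iff_subsingleton.1 fun h => htriv ⟨M, iM, hM, h⟩
    exact Subsingleton.elim _ _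
  · refine hK'.mem_of_separated halg fun a b hab => ?_
    obtain ⟨S, iS, hS, hsdi, g, hg⟩ := hK.exists_relSDI halg hA hab
    refine ⟨S, iS, ?_, g, hg⟩
    obtain ⟨-, hnS, hsimple⟩ := hss S hS hsdi
    obtain ⟨ι, uf, ⟨h⟩⟩ := mapsIntoUltrapower_of_isEP halg
      (hpsc S B hS (hsub B iB hB) hnS hnB)
    have hU := hK'.ultra_closed ι (fun _ => B) uf fun _ => hB
    by_cases hR : Nontrivial h.range
    · have hinj : Function.Injective h := fun x y hxy =>
        hsimple h.range (hK.sub_closed _ _ ⟨h.range.subtype⟩ (hsub _ _ hU)) hR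
          (Hom.codRestrict h.range h h.mem_range_self)
          (by rintro ⟨_, x, rfl⟩; exact ⟨x, rfl⟩) (Subtype.ext hxy)
      exact hK'.sub_closed S _ ⟨Embedding.ofInjective hinj⟩ hU
    · rw [not_nontrivial_iff_subsingleton] at hR
      obtain ⟨s⟩ : Nonempty S := inferInstance
      have hU' : Nontrivial ((uf : Filter ι).Product fun _ => B) := by
        obtain ⟨b₀, b₁, hb⟩ := exists_pair_ne B
        refine ⟨Quotient.mk'' fun _ => b₀, Quotient.mk'' fun _ => b₁, fun h => hb ?_⟩
        exact (Filter.Eventually.exists (Quotient.eq''.1 h)).choose_spec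
      refine (hpass (noPassiveQEq_of_isPSC_of_idempotent hK hpsc (hsub _ _ hU)
        ⟨h s, fun n f => ?_⟩)).elim
      have := Subsingleton.elim (⟨h (funMap f fun _ => s), _, rfl⟩ : h.range) ⟨h s, s, rfl⟩
      exact (h.map_fun f fun _ => s).symm.trans (congrArg Subtype.val this)

/-- a relatively semisimple algebraic quasivariety is PSC iff it
is a minimal quasivariety or no quasi-equation is passive over it. -/
theorem statement_16 (L : FirstOrder.Language.{u, u}) (halg : L.IsAlgebraic)
    (K : StructClass L) (hK : IsQuasivariety K) (hss : RelSemisimple K) :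
    IsPSC K ↔ (MinimalQV K ∨ NoPassiveQEq K) := by
  refine ⟨fun hpsc => ?_, fun h => h.elim (isPSC_of_minimalQV hK) (isPSC_of_noPassiveQEq halg)⟩
  by_cases hpass : NoPassiveQEq K
  · exact Or.inr hpass
  · exact Or.inl (minimalQV_of_isPSC halg hK hss hpsc hpass)

end Paper
end

section
/- Let K be a variety of Dunn monoids. If the reflection R(K) is structurally complete, then K is structurally complete. Equivalently, if K is structurally incomplete (i.e., K = H(L) for some proper subquasivariety L of K), then R(K) is structurally incomplete. -/
universe u

open FirstOrder Language Structure

namespace Paper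

variable {L : FirstOrder.Language.{u, u}}

/-! ### The language of De Morgan monoids -/

/-- Operation symbols for De Morgan monoids: fusion, meet, join, involution
and the monoid identity. -/
inductive DMMOp : ℕ → Type
  | mul : DMMOp 2
  | meet : DMMOp 2
  | join : DMMOp 2
  | neg : DMMOp 1
  | e : DMMOp 0

/-- The (algebraic) language of De Morgan monoids. -/
def DMMLang : FirstOrder.Language.{0, 0} :=
  { Functions := DMMOp, Relations := fun _ => Empty }

section DMMOps

variable {B : Type} [iB : DMMLang.Structure B]

/-- Fusion. -/
def mP (a b : B) : B := funMap (L := DMMLang) DMMOp.mul ![a, b]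
/-- Meet. -/
def mM (a b : B) : B := funMap (L := DMMLang) DMMOp.meet ![a, b]
/-- Join. -/
def mJ (a b : B) : B := funMap (L := DMMLang) DMMOp.join ![a, b]
/-- Involution. -/
def mN (a : B) : B := funMap (L := DMMLang) DMMOp.neg ![a]
/-- Monoid identity. -/
def mE : B := funMap (L := DMMLang) DMMOp.e ![]
/-- Lattice order. -/
def mLe (a b : B) : Prop := mM a b = a
/-- Strict lattice order. -/
def mLt (a b : B) : Prop := mLe a b ∧ a ≠ b

end DMMOps

/-- A De Morgan monoid: a distributive lattice with a square-increasing
commutative monoid structure and an involution `¬` such that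
`x·y ≤ z ↔ x·¬z ≤ ¬y`. -/
def IsDMM (B : Type) [iB : DMMLang.Structure B] : Prop :=
  (∀ a b : B, mM a b = mM b a) ∧
  (∀ a b c : B, mM (mM a b) c = mM a (mM b c)) ∧
  (∀ a b : B, mJ a b = mJ b a) ∧
  (∀ a b c : B, mJ (mJ a b) c = mJ a (mJ b c)) ∧
  (∀ a b : B, mM a (mJ a b) = a) ∧
  (∀ a b : B, mJ a (mM a b) = a) ∧
  (∀ a b c : B, mM a (mJ b c) = mJ (mM a b) (mM a c)) ∧
  (∀ a b : B, mP a b = mP b a) ∧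
  (∀ a b c : B, mP (mP a b) c = mP a (mP b c)) ∧
  (∀ a : B, mP mE a = a) ∧
  (∀ a : B, mLe a (mP a a)) ∧
  (∀ a : B, mN (mN a) = a) ∧
  (∀ a b c : B, mLe (mP a b) c ↔ mLe (mP a (mN c)) (mN b))

/-! ### The language of Dunn monoids -/

/-- Operation symbols for Dunn monoids: fusion, residuation, meet, join and
the monoid identity. -/
inductive DunnOp : ℕ → Type
  | mul : DunnOp 2
  | imp : DunnOp 2
  | meet : DunnOp 2
  | join : DunnOp 2
  | e : DunnOp 0

/-- The (algebraic) language of Dunn monoids. -/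
def DunnLang : FirstOrder.Language.{0, 0} :=
  { Functions := DunnOp, Relations := fun _ => Empty }

section DunnOps

variable {A : Type} [iA : DunnLang.Structure A]

/-- Fusion. -/
def dP (a b : A) : A := funMap (L := DunnLang) DunnOp.mul ![a, b]
/-- Residuation. -/
def dI (a b : A) : A := funMap (L := DunnLang) DunnOp.imp ![a, b]
/-- Meet. -/
def dM (a b : A) : A := funMap (L := DunnLang) DunnOp.meet ![a, b]
/-- Join. -/
def dJ (a b : A) : A := funMap (L := DunnLang) DunnOp.join ![a, b]
/-- Monoid identity. -/
def dE : A := funMap (L := DunnLang) DunnOp.e ![]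
/-- Lattice order. -/
def dLe (a b : A) : Prop := dM a b = a

end DunnOps

/-- A Dunn monoid: a distributive lattice with a square-increasing commutative
monoid structure and a residuation operation `→` satisfying
`x·y ≤ z ↔ y ≤ x → z`. -/
def IsDunn (A : Type) [iA : DunnLang.Structure A] : Prop :=
  (∀ a b : A, dM a b = dM b a) ∧
  (∀ a b c : A, dM (dM a b) c = dM a (dM b c)) ∧
  (∀ a b : A, dJ a b = dJ b a) ∧
  (∀ a b c : A, dJ (dJ a b) c = dJ a (dJ b c)) ∧
  (∀ a b : A, dM a (dJ a b) = a) ∧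
  (∀ a b : A, dJ a (dM a b) = a) ∧
  (∀ a b c : A, dM a (dJ b c) = dJ (dM a b) (dM a c)) ∧
  (∀ a b : A, dP a b = dP b a) ∧
  (∀ a b c : A, dP (dP a b) c = dP a (dP b c)) ∧
  (∀ a : A, dP dE a = a) ∧
  (∀ a : A, dLe a (dP a a)) ∧
  (∀ a b c : A, dLe (dP a b) c ↔ dLe b (dI a c))

/-- `B` is (isomorphic to) the reflection `R(A)` of the Dunn monoid `A`:
a De Morgan monoid on `A ∪ A' ∪ {⊥, ⊤}` as in Definition 8.3 of the paper,
where `i` embeds `A` and `p` is the map `a ↦ a'`, `⊤ = f²` and `⊥ = ¬(f²)`. -/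
def IsReflectionOf (B : Type) [iB : DMMLang.Structure B]
    (A : Type) [iA : DunnLang.Structure A] : Prop :=
  IsDMM B ∧
  ∃ i p : A → B,
    (let top : B := mP (mN mE) (mN mE)
     let bot : B := mN top
     Function.Injective i ∧ Function.Injective p ∧
     (∀ a b : A, i a ≠ p b) ∧
     (∀ a : A, i a ≠ bot ∧ i a ≠ top ∧ p a ≠ bot ∧ p a ≠ top) ∧
     (∀ x : B, (∃ a, i a = x) ∨ (∃ a, p a = x) ∨ x = bot ∨ x = top) ∧
     (∀ a b : A, i (dP a b) = mP (i a) (i b)) ∧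
     (∀ a b : A, i (dM a b) = mM (i a) (i b)) ∧
     (∀ a b : A, i (dJ a b) = mJ (i a) (i b)) ∧
     (i (dE : A) = (mE : B)) ∧
     (∀ a b : A, i (dI a b) = mN (mP (i a) (mN (i b)))) ∧
     (∀ a : A, mN (i a) = p a) ∧
     (∀ a : A, mN (p a) = i a) ∧
     mN bot = top ∧ mN top = bot ∧
     (∀ x : B, mP x bot = bot) ∧
     (∀ a : A, mLt bot (i a)) ∧
     (∀ a b : A, mLt (i a) (p b)) ∧
     (∀ a : A, mLt (p a) top) ∧
     (∀ a b : A, mP (p a) (p b) = top) ∧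
     (∀ x : B, x ≠ bot → mP x top = top) ∧
     (∀ a b : A, mP (i a) (p b) = p (dI a b)))

/-- The class of reflections of members of a class `K` of Dunn monoids. -/
def ReflClass (K : StructClass DunnLang) : StructClass DMMLang :=
  fun B iB => ∃ (A : Type) (iA : DunnLang.Structure A),
    K A iA ∧ @IsReflectionOf B iB A iA

/-! ### Algebraic languages, homomorphic images and separation by homomorphisms -/

instance : DMMLang.IsAlgebraic := fun _ => inferInstanceAs (IsEmpty Empty)

instance : DunnLang.IsAlgebraic := fun _ => inferInstanceAs (IsEmpty Empty)

section Products

attribute [local instance] piStructure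

variable {ι : Type u} (M : ι → Type u) [∀ i, L.Structure (M i)]

/-- The `i`-th projection of a product of structures. -/
def projHom (i : ι) : (∀ i, M i) →[L] M i where
  toFun x := x i
  map_fun' _ _ := rfl
  map_rel' _ _ h := h i

variable {M}

/-- The homomorphism into a product with given components. -/
def liftHom {A : Type u} [L.Structure A] (f : ∀ i, A →[L] M i) : A →[L] (∀ i, M i) where
  toFun a i := f i a
  map_fun' F x := funext fun i => (f i).map_fun F x
  map_rel' r x h i := (f i).map_rel r x h

/-- The canonical homomorphism from a product onto an ultraproduct. -/
def ultraproductMk [L.IsAlgebraic] (uf : Ultrafilter ι) :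
    (∀ i, M i) →[L] (uf : Filter ι).Product M where
  toFun x := (x : (uf : Filter ι).Product M)
  map_fun' F x := (Ultraproduct.funMap_cast F x).symm
  map_rel' r := isEmptyElim r

theorem ultraproductMk_surjective [L.IsAlgebraic] (uf : Ultrafilter ι) :
    Function.Surjective (ultraproductMk (L := L) (M := M) uf) :=
  fun y => Quotient.inductionOn' y fun x => ⟨x, rfl⟩

theorem ultraproductMk_eq_iff [L.IsAlgebraic] (uf : Ultrafilter ι) (x y : ∀ i, M i) :
    ultraproductMk (L := L) uf x = ultraproductMk (L := L) uf y ↔ ∀ᶠ i in uf, x i = y i :=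
  Quotient.eq''

end Products

/-- A map that becomes a homomorphism after composition with a surjective homomorphism is a
homomorphism. -/
theorem exists_hom_of_comp_surjective [L.IsAlgebraic] {A B C : Type u} [L.Structure A]
    [L.Structure B] [L.Structure C] (s : A →[L] B) (hs : Function.Surjective s)
    (g : A →[L] C) (f : B → C) (hf : ∀ a, f (s a) = g a) : ∃ F : B →[L] C, ⇑F = f := by
  refine ⟨⟨f, fun {n} o x => ?_, fun r => isEmptyElim r⟩, rfl⟩
  choose t ht using fun j => hs (x j)
  obtain rfl : s ∘ t = x := funext ht
  rw [← s.map_fun, hf, g.map_fun]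
  congr 1
  funext j
  exact (hf _).symm

/-- In an algebraic language, a bijective homomorphism has an inverse homomorphism. -/
theorem exists_inverse_hom [L.IsAlgebraic] {M N : Type u} [L.Structure M] [L.Structure N]
    (f : M →[L] N) (hf : Function.Bijective f) :
    ∃ g : N →[L] M, ∀ y, f (g y) = y := by
  let e := _root_.Equiv.ofBijective f hf
  have he : ∀ y, f (e.symm y) = y := fun y => e.apply_symm_apply y
  refine ⟨⟨e.symm, fun {n} F x => hf.1 ?_, fun r => isEmptyElim r⟩, he⟩
  rw [he, f.map_fun]
  congr 1
  funext j
  exact (he _).symm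

/-- A class closed under substructures and products contains every algebra whose points are
separated by homomorphisms into members of the class. -/
theorem mem_of_separated [L.IsAlgebraic] {K : StructClass L}
    (hsub : ∀ (M : Type u) [iM : L.Structure M] (N : Type u) [iN : L.Structure N],
      Nonempty (M ↪[L] N) → K N iN → K M iM)
    (hprod : ∀ (ι : Type u) (M : ι → Type u) [iM : ∀ i, L.Structure (M i)],
      (∀ i, K (M i) (iM i)) → K (∀ i, M i) (piStructure M))
    (A : Type u) [iA : L.Structure A]
    (h : ∀ a b : A, a ≠ b → ∃ (C : Type u) (iC : L.Structure C), K C iC ∧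
      ∃ f : A →[L] C, f a ≠ f b) : K A iA := by
  let ι := {p : A × A // p.1 ≠ p.2}
  have h' : ∀ i : ι, ∃ (C : Type u) (iC : L.Structure C), K C iC ∧
      ∃ f : A →[L] C, f i.1.1 ≠ f i.1.2 := fun i => h _ _ i.2
  choose C iC hC f hf using h'
  let _ := piStructure (L := L) C
  refine hsub A (∀ i, C i) ⟨⟨⟨fun a i => f i a, ?_⟩, ?_, fun r => isEmptyElim r⟩⟩ (hprod ι C hC)
  · intro a b hab
    by_contra hne
    exact hf ⟨(a, b), hne⟩ (congrFun hab ⟨(a, b), hne⟩)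
  · intro n F x
    funext i
    exact (f i).map_fun F x

/-- The class of homomorphic images of members of `K`. -/
def HomImages (K : StructClass L) : StructClass L :=
  fun A iA => ∃ (B : Type u) (iB : L.Structure B), K B iB ∧
    ∃ h : @FirstOrder.Language.Hom L B A iB iA, Function.Surjective h

theorem IsQuasivariety.isVariety_homImages [L.IsAlgebraic] {K : StructClass L}
    (hK : IsQuasivariety K) : IsVariety (HomImages K) where
  iso_closed := by
    rintro M iM N iN ⟨e⟩ ⟨B, iB, hB, h, hh⟩
    exact ⟨B, iB, hB, e.toHom.comp h, e.surjective.comp hh⟩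
  hom_closed := by
    rintro M iM N iN ⟨g, hg⟩ ⟨B, iB, hB, h, hh⟩
    exact ⟨B, iB, hB, g.comp h, hg.comp hh⟩
  sub_closed := by
    rintro M iM N iN ⟨e⟩ ⟨B, iB, hB, h, hh⟩
    let S : L.Substructure B := e.toHom.range.comap h
    have hS : ∀ b : S, ∃ m : M, e m = h b := fun b => b.2
    choose g hg using hS
    refine ⟨S, inferInstance, hK.sub_closed S B ⟨S.subtype⟩ hB,
      ⟨g, fun {n} F x => e.injective ?_, fun r => isEmptyElim r⟩, fun m => ?_⟩
    · rw [hg, e.map_fun]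
      change h (S.subtype (funMap F x)) = _
      rw [S.subtype.map_fun, h.map_fun]
      congr 1
      funext j
      exact (hg (x j)).symm
    · obtain ⟨b, hb⟩ := hh (e m)
      exact ⟨⟨b, m, hb.symm⟩, e.injective ((hg _).trans hb)⟩
  prod_closed := by
    intro ι M iM h
    choose B iB hB f hf using h
    let _ := piStructure (L := L) B
    let _ := piStructure (L := L) M
    refine ⟨∀ i, B i, inferInstance, hK.prod_closed ι B hB,
      ⟨fun x i => f i (x i), fun {n} F x => ?_, fun r => isEmptyElim r⟩, fun y => ?_⟩
    · funext i
      exact (f i).map_fun F _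
    · choose x hx using fun i => hf i (y i)
      exact ⟨x, funext hx⟩

theorem subClass_vGen (C : StructClass L) : SubClass C (VGen C) :=
  fun M iM h _ _ hC => hC M iM h

theorem isVariety_vGen (C : StructClass L) : IsVariety (VGen C) where
  iso_closed M _ N _ e h K hK hC := hK.iso_closed M N e (h K hK hC)
  hom_closed M _ N _ e h K hK hC := hK.hom_closed M N e (h K hK hC)
  sub_closed M _ N _ e h K hK hC := hK.sub_closed M N e (h K hK hC)
  prod_closed ι M _ h K hK hC := hK.prod_closed ι M fun i => h i K hK hC

/-- A family of maps that are homomorphisms on a set of the ultrafilter induces a homomorphism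
of ultraproducts. -/
theorem exists_ultraproduct_hom [L.IsAlgebraic] {ι : Type u} (uf : Ultrafilter ι)
    {M N : ι → Type u} [∀ i, L.Structure (M i)] [∀ i, L.Structure (N i)]
    (f : ∀ i, M i → N i) (hf : ∀ᶠ i in uf, ∃ g : M i →[L] N i, ⇑g = f i) :
    ∃ F : ((uf : Filter ι).Product M) →[L] ((uf : Filter ι).Product N),
      ∀ x : ∀ i, M i, F (ultraproductMk (L := L) uf x) =
        ultraproductMk (L := L) uf fun i => f i (x i) := by
  let F : (uf : Filter ι).Product M → (uf : Filter ι).Product N :=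
    Quotient.map' (fun x i => f i (x i)) fun x y hxy => by
      filter_upwards [hxy] with i hi
      exact congrArg (f i) hi
  refine ⟨⟨F, fun {n} o x => ?_, fun r => isEmptyElim r⟩, fun x => rfl⟩
  choose y hy using fun j => ultraproductMk_surjective (L := L) uf (x j)
  obtain rfl : (fun j => ultraproductMk (L := L) uf (y j)) = x := funext hy
  have h1 := Ultraproduct.funMap_cast (u := uf) (M := M) o y
  have h2 := Ultraproduct.funMap_cast (u := uf) (M := N) o fun j i => f i (y j i)
  refine (congrArg F h1).trans (Eq.trans (Quotient.sound' ?_) h2.symm)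
  filter_upwards [hf] with i ⟨g, hg⟩
  change f i (funMap o fun j => y j i) = funMap o fun j => f i (y j i)
  rw [← hg, g.map_fun]
  rfl

/-! ### Homomorphisms of De Morgan and Dunn monoids -/

section Operations

variable {M N : Type u} [L.Structure M] [L.Structure N]

theorem map_funMap_zero (f : M →[L] N) (o : L.Functions 0) : f (funMap o ![]) = funMap o ![] :=
  (f.map_fun o _).trans (congrArg _ (Subsingleton.elim _ _))

theorem map_funMap_one (f : M →[L] N) (o : L.Functions 1) (a : M) :
    f (funMap o ![a]) = funMap o ![f a] :=
  (f.map_fun o _).trans (congrArg _ (by funext j; fin_cases j; rfl))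

theorem map_funMap_two (f : M →[L] N) (o : L.Functions 2) (a b : M) :
    f (funMap o ![a, b]) = funMap o ![f a, f b] :=
  (f.map_fun o _).trans (congrArg _ (by funext j; fin_cases j <;> rfl))

theorem map_funMap_of_zero {f : M → N} {o : L.Functions 0}
    (h : f (funMap o ![]) = funMap o ![]) (x : Fin 0 → M) :
    f (funMap o x) = funMap o (f ∘ x) := by
  obtain rfl : x = ![] := Subsingleton.elim _ _
  exact h.trans (congrArg _ (Subsingleton.elim _ _))

theorem map_funMap_of_one {f : M → N} {o : L.Functions 1}
    (h : ∀ a, f (funMap o ![a]) = funMap o ![f a]) (x : Fin 1 → M) :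
    f (funMap o x) = funMap o (f ∘ x) := by
  obtain ⟨a, rfl⟩ : ∃ a, x = ![a] := ⟨x 0, by funext j; fin_cases j; rfl⟩
  exact (h a).trans (congrArg _ (by funext j; fin_cases j; rfl))

theorem map_funMap_of_two {f : M → N} {o : L.Functions 2}
    (h : ∀ a b, f (funMap o ![a, b]) = funMap o ![f a, f b]) (x : Fin 2 → M) :
    f (funMap o x) = funMap o (f ∘ x) := by
  obtain ⟨a, b, rfl⟩ : ∃ a b, x = ![a, b] := ⟨x 0, x 1, by funext j; fin_cases j <;> rfl⟩
  exact (h a b).trans (congrArg _ (by funext j; fin_cases j <;> rfl))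

end Operations

section Homs

variable {B C : Type} [DMMLang.Structure B] [DMMLang.Structure C]

/-- A homomorphism in the language of De Morgan monoids, from preservation of each operation. -/
def dmmHom (f : B → C) (hP : ∀ a b, f (mP a b) = mP (f a) (f b))
    (hM : ∀ a b, f (mM a b) = mM (f a) (f b)) (hJ : ∀ a b, f (mJ a b) = mJ (f a) (f b))
    (hN : ∀ a, f (mN a) = mN (f a)) (hE : f mE = mE) : B →[DMMLang] C where
  toFun := f
  map_fun' {_} o := match o with
    | DMMOp.mul => map_funMap_of_two (L := DMMLang) hP
    | DMMOp.meet => map_funMap_of_two (L := DMMLang) hM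
    | DMMOp.join => map_funMap_of_two (L := DMMLang) hJ
    | DMMOp.neg => map_funMap_of_one (L := DMMLang) hN
    | DMMOp.e => map_funMap_of_zero (L := DMMLang) hE
  map_rel' r := isEmptyElim r

theorem map_mP (f : B →[DMMLang] C) (a b : B) : f (mP a b) = mP (f a) (f b) :=
  map_funMap_two f _ a b

theorem map_mM (f : B →[DMMLang] C) (a b : B) : f (mM a b) = mM (f a) (f b) :=
  map_funMap_two f _ a b

theorem map_mJ (f : B →[DMMLang] C) (a b : B) : f (mJ a b) = mJ (f a) (f b) :=
  map_funMap_two f _ a b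

theorem map_mN (f : B →[DMMLang] C) (a : B) : f (mN a) = mN (f a) :=
  map_funMap_one f _ a

theorem map_mE (f : B →[DMMLang] C) : f mE = mE :=
  map_funMap_zero f _

end Homs

section DunnHoms

variable {A D : Type} [DunnLang.Structure A] [DunnLang.Structure D]

/-- A homomorphism in the language of Dunn monoids, from preservation of each operation. -/
def dunnHom (f : A → D) (hP : ∀ a b, f (dP a b) = dP (f a) (f b))
    (hI : ∀ a b, f (dI a b) = dI (f a) (f b))
    (hM : ∀ a b, f (dM a b) = dM (f a) (f b)) (hJ : ∀ a b, f (dJ a b) = dJ (f a) (f b))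
    (hE : f dE = dE) : A →[DunnLang] D where
  toFun := f
  map_fun' {_} o := match o with
    | DunnOp.mul => map_funMap_of_two (L := DunnLang) hP
    | DunnOp.imp => map_funMap_of_two (L := DunnLang) hI
    | DunnOp.meet => map_funMap_of_two (L := DunnLang) hM
    | DunnOp.join => map_funMap_of_two (L := DunnLang) hJ
    | DunnOp.e => map_funMap_of_zero (L := DunnLang) hE
  map_rel' r := isEmptyElim r

theorem map_dP (f : A →[DunnLang] D) (a b : A) : f (dP a b) = dP (f a) (f b) :=
  map_funMap_two f _ a b

theorem map_dI (f : A →[DunnLang] D) (a b : A) : f (dI a b) = dI (f a) (f b) :=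
  map_funMap_two f _ a b

theorem map_dM (f : A →[DunnLang] D) (a b : A) : f (dM a b) = dM (f a) (f b) :=
  map_funMap_two f _ a b

theorem map_dJ (f : A →[DunnLang] D) (a b : A) : f (dJ a b) = dJ (f a) (f b) :=
  map_funMap_two f _ a b

theorem map_dE (f : A →[DunnLang] D) : f dE = dE :=
  map_funMap_zero f _

end DunnHoms

section DeMorgan

variable {B : Type} [DMMLang.Structure B]

theorem IsDMM.mN_mJ (hB : IsDMM B) (x y : B) : mN (mJ x y) = mM (mN x) (mN y) := by
  obtain ⟨mc, ma, jc, ja, mj, jm, -, -, -, pe, -, nn, rs⟩ := hB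
  simp only [mLe] at rs
  have anti : ∀ b c : B, mM b c = b → mM (mN c) (mN b) = mN c := fun b c h => by
    have := (rs mE b c).1 (by rwa [pe])
    rwa [pe] at this
  have anti' : ∀ b c : B, mM b (mN c) = b → mM c (mN b) = c := fun b c h => by
    have := anti _ _ h
    rwa [nn] at this
  have le_iff : ∀ a b : B, mM a b = a → mJ a b = b := fun a b h => by rw [← h, jc, mc, jm]
  have h1 : mM (mN (mJ x y)) (mN x) = mN (mJ x y) := anti _ _ (mj x y)
  have h2 : mM (mN (mJ x y)) (mN y) = mN (mJ x y) := anti _ _ (by rw [jc, mj])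
  have mi : ∀ a : B, mM a a = a := fun a => by
    have h := mj a (mM a a)
    rwa [jm] at h
  have g1 := le_iff _ _ (anti' (mM (mN x) (mN y)) x (by rw [mc, ← ma, mi]))
  have g2 := le_iff _ _ (anti' (mM (mN x) (mN y)) y (by rw [ma, mi]))
  have g : mM (mM (mN x) (mN y)) (mN (mJ x y)) = mM (mN x) (mN y) := by
    apply anti'
    rw [← g2, ← g1, ← ja y, jc y x, mj]
  rw [← g, mc, ← ma, h1, h2]

theorem IsDMM.mN_mM (hB : IsDMM B) (x y : B) : mN (mM x y) = mJ (mN x) (mN y) := by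
  have nn : ∀ a : B, mN (mN a) = a := hB.2.2.2.2.2.2.2.2.2.2.2.1
  rw [← nn (mJ _ _), hB.mN_mJ, nn, nn]

end DeMorgan

/-! ### The reflection construction -/

/-- The universe `A ∪ A' ∪ {⊥, ⊤}` of the reflection of `A`. -/
inductive Refl (A : Type) : Type
  | bot : Refl A
  | pos : A → Refl A
  | neg : A → Refl A
  | top : Refl A

namespace Refl

variable {A : Type} [DunnLang.Structure A]

/-- Fusion on the reflection. -/
def mul : Refl A → Refl A → Refl A
  | bot, _ => bot
  | _, bot => bot
  | top, _ => top
  | _, top => top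
  | pos a, pos b => pos (dP a b)
  | pos a, neg b => neg (dI a b)
  | neg a, pos b => neg (dI b a)
  | neg _, neg _ => top

/-- Meet on the reflection. -/
def meet : Refl A → Refl A → Refl A
  | bot, _ => bot
  | _, bot => bot
  | top, x => x
  | x, top => x
  | pos a, pos b => pos (dM a b)
  | pos a, neg _ => pos a
  | neg _, pos b => pos b
  | neg a, neg b => neg (dJ a b)

/-- Join on the reflection. -/
def join : Refl A → Refl A → Refl A
  | bot, x => x
  | x, bot => x
  | top, _ => top
  | _, top => top
  | pos a, pos b => pos (dJ a b)
  | pos _, neg b => neg b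
  | neg a, pos _ => neg a
  | neg a, neg b => neg (dM a b)

/-- Involution on the reflection. -/
def compl : Refl A → Refl A
  | bot => top
  | pos a => neg a
  | neg a => pos a
  | top => bot

instance : DMMLang.Structure (Refl A) where
  funMap {_} o := match o with
    | DMMOp.mul => fun x => mul (x 0) (x 1)
    | DMMOp.meet => fun x => meet (x 0) (x 1)
    | DMMOp.join => fun x => join (x 0) (x 1)
    | DMMOp.neg => fun x => compl (x 0)
    | DMMOp.e => fun _ => pos dE
  RelMap r := isEmptyElim r

theorem mP_eq (x y : Refl A) : mP x y = mul x y := rfl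
theorem mM_eq (x y : Refl A) : mM x y = meet x y := rfl
theorem mJ_eq (x y : Refl A) : mJ x y = join x y := rfl
theorem mN_eq (x : Refl A) : mN x = compl x := rfl
theorem mE_eq : (mE : Refl A) = pos dE := rfl

theorem isDMM (hA : IsDunn A) : IsDMM (Refl A) := by
  obtain ⟨mc, ma, jc, ja, mj, jm, ds, pc, pa, pe, sq, rs⟩ := hA
  simp only [dLe] at sq rs
  have mi : ∀ a : A, dM a a = a := fun a => by
    have h := mj a (dM a a)
    rwa [jm] at h
  have ji : ∀ a : A, dJ a a = a := fun a => by
    have h := jm a (dJ a a)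
    rwa [mj] at h
  have le_iff : ∀ a b : A, dJ a b = a ↔ dM b a = b := fun a b =>
    ⟨fun h => by rw [← h, jc, mj], fun h => by rw [← h, mc, jm]⟩
  have dj : ∀ a b c : A, dJ a (dM b c) = dM (dJ a b) (dJ a c) := fun a b c => by
    rw [ds (dJ a b) a c, mc (dJ a b) a, mj, mc (dJ a b) c, ds c a b, ← ja, mc c a, jm, mc c b]
  have jm' : ∀ a b : A, dJ (dM a b) a = a := fun a b => by rw [jc, jm]
  have mj' : ∀ a b : A, dM (dJ a b) a = a := fun a b => by rw [mc, mj]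
  have anti : ∀ a b : A, dM a b = a → dM b a = b → a = b := fun a b h1 h2 => by
    rw [← h1, mc, h2]
  have ii : ∀ a b c : A, dI a (dI b c) = dI (dP a b) c := fun a b c => by
    apply anti
    · rw [← rs, pc a b, pa, rs, rs, mi]
    · rw [← rs, ← rs, ← pa, pc b a, rs, mi]
  have ie : ∀ a : A, dI dE a = a := fun a => by
    apply anti
    · rw [← pe (dI dE a), rs, mi]
    · rw [← rs, pe, mi]
  have ex : ∀ a b c : A, dM a (dI b c) = a ↔ dM b (dI a c) = b := fun a b c => by
    rw [← rs, ← rs, pc]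
  have pe' : ∀ a : A, dP a dE = a := fun a => by rw [pc, pe]
  refine ⟨?_, ?_, ?_, ?_, ?_, ?_, ?_, ?_, ?_, ?_, ?_, ?_, ?_⟩
  · rintro (_ | a | a | _) (_ | b | b | _) <;> simp [mM_eq, meet, mc, jc]
  · rintro (_ | a | a | _) (_ | b | b | _) (_ | c | c | _) <;> simp [mM_eq, meet, ma, ja]
  · rintro (_ | a | a | _) (_ | b | b | _) <;> simp [mJ_eq, join, mc, jc]
  · rintro (_ | a | a | _) (_ | b | b | _) (_ | c | c | _) <;> simp [mJ_eq, join, ma, ja]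
  · rintro (_ | a | a | _) (_ | b | b | _) <;> simp [mJ_eq, mM_eq, meet, join, mj, jm, mi, ji]
  · rintro (_ | a | a | _) (_ | b | b | _) <;> simp [mJ_eq, mM_eq, meet, join, mj, jm, mi, ji]
  · rintro (_ | a | a | _) (_ | b | b | _) (_ | c | c | _) <;>
      simp [mJ_eq, mM_eq, meet, join, mj, jm, mi, ji] <;>
      first | exact ds _ _ _ | exact dj _ _ _ | exact (jm' _ _).symm | exact (mj' _ _).symm
  · rintro (_ | a | a | _) (_ | b | b | _) <;> simp [mP_eq, mul, pc]
  · rintro (_ | a | a | _) (_ | b | b | _) (_ | c | c | _) <;> simp [mP_eq, mul, pa, ii] <;> grind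
  · rintro (_ | a | a | _) <;> simp [mP_eq, mE_eq, mul, pe, ie]
  · rintro (_ | a | a | _) <;> simp [mP_eq, mM_eq, mLe, mul, meet, sq]
  · rintro (_ | a | a | _) <;> simp [mN_eq, compl]
  · rintro (_ | a | a | _) (_ | b | b | _) (_ | c | c | _) <;>
      simp [mP_eq, mM_eq, mN_eq, mLe, mul, meet, compl, le_iff, rs] <;> grind

theorem isReflectionOf (hA : IsDunn A) : IsReflectionOf (Refl A) A := by
  refine ⟨isDMM hA, pos, neg, ?_⟩
  simp only [mP_eq, mM_eq, mJ_eq, mN_eq, mE_eq, mLt, mLe, compl, mul]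
  refine ⟨fun _ _ => pos.inj, fun _ _ => neg.inj, ?_, ?_, ?_, ?_, ?_, ?_, ?_, ?_, ?_, ?_, ?_, ?_,
    ?_, ?_, ?_, ?_, ?_, ?_, ?_⟩
  all_goals first
    | (rintro (_ | a | a | _) <;> simp)
    | simp [meet, join]

/-- A homomorphism of Dunn monoids extends to the reflections. -/
def map {D : Type} [DunnLang.Structure D] (f : A →[DunnLang] D) : Refl A →[DMMLang] Refl D :=
  dmmHom (fun
      | bot => bot
      | pos a => pos (f a)
      | neg a => neg (f a)
      | top => top)
    (by
      rintro (_ | a | a | _) (_ | b | b | _) <;> simp [mP_eq, mul, map_dP, map_dI])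
    (by
      rintro (_ | a | a | _) (_ | b | b | _) <;> simp [mM_eq, meet, map_dM, map_dJ])
    (by
      rintro (_ | a | a | _) (_ | b | b | _) <;> simp [mJ_eq, join, map_dM, map_dJ])
    (by
      rintro (_ | a | a | _) <;> simp [mN_eq, compl])
    (by simp [mE_eq, map_dE])

theorem map_surjective {D : Type} [DunnLang.Structure D] (f : A →[DunnLang] D)
    (hf : Function.Surjective f) : Function.Surjective (map f) := by
  rintro (_ | d | d | _)
  · exact ⟨bot, rfl⟩
  · obtain ⟨a, rfl⟩ := hf d
    exact ⟨pos a, rfl⟩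
  · obtain ⟨a, rfl⟩ := hf d
    exact ⟨neg a, rfl⟩
  · exact ⟨top, rfl⟩

theorem exists_surjective_of_isReflectionOf (B : Type) [DMMLang.Structure B]
    (hB : IsReflectionOf B A) : ∃ f : Refl A →[DMMLang] B, Function.Surjective f := by
  obtain ⟨hD, i, p, h⟩ := hB
  have dm1 := hD.mN_mJ
  have dm2 := hD.mN_mM
  obtain ⟨mc, ma, jc, ja, mj, jm, -, pc, -, -, -, nn, -⟩ := hD
  simp only [mLt, mLe] at h
  generalize ht : mP (mN (mE : B)) (mN mE) = t at h
  generalize hb : mN t = b at h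
  obtain ⟨-, -, -, hne, hsurj, iP, iM, iJ, iE, iI, Ni, Np, Nb, Nt, Pb, bi, ip, pt, pp, Pt, iPp⟩ := h
  have mi : ∀ a : B, mM a a = a := fun a => by
    have h := mj a (mM a a)
    rwa [jm] at h
  have trans : ∀ x y z : B, mM x y = x → mM y z = y → mM x z = x := fun x y z h1 h2 => by
    rw [← h1, ma, h2]
  have mle : ∀ x y : B, mM x y = x → mM x y = x ∧ mM y x = x ∧ mJ x y = y ∧ mJ y x = y :=
    fun x y h => by
      have h' : mJ x y = y := by rw [← h, jc, mc, jm]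
      exact ⟨h, by rw [mc, h], h', by rw [jc, h']⟩
  have bp : ∀ a, mM b (p a) = b := fun a => trans _ _ _ (bi a).1 (ip a a).1
  have it : ∀ a, mM (i a) t = i a := fun a => trans _ _ _ (ip a a).1 (pt a).1
  have bt : mM b t = b := trans _ _ _ (bi dE).1 (it dE)
  have ji : ∀ a : B, mJ a a = a := fun a => (mle a a (mi a)).2.2.1
  have Pb' : ∀ x, mP b x = b := fun x => by rw [pc, Pb]
  have Pt' : ∀ x, x ≠ b → mP t x = t := fun x hx => by rw [pc, Pt x hx]
  have Ptt : mP t t = t := by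
    by_cases h : t = b
    · rw [h, Pb]
    · exact Pt t h
  have pM : ∀ x y, p (dM x y) = mJ (p x) (p y) := fun x y => by
    rw [← Ni, iM, dm2, Ni, Ni]
  have pJ : ∀ x y, p (dJ x y) = mM (p x) (p y) := fun x y => by
    rw [← Ni, iJ, dm1, Ni, Ni]
  let f : Refl A → B
    | bot => b
    | pos a => i a
    | neg a => p a
    | top => t
  refine ⟨dmmHom f ?_ ?_ ?_ ?_ iE, fun x => ?_⟩
  · rintro (_ | x | x | _) (_ | y | y | _) <;>
      simp [f, mP_eq, mul, Pb, Pb', Ptt, iP, pp, Pt, Pt', hne, iPp]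
    rw [pc, iPp]
  · rintro (_ | x | x | _) (_ | y | y | _) <;>
      simp [f, mM_eq, meet, iM, pJ, mi, mle _ _ (bi _).1, mle _ _ (bp _), mle _ _ (it _),
        mle _ _ (pt _).1, mle _ _ bt, mle _ _ (ip _ _).1]
  · rintro (_ | x | x | _) (_ | y | y | _) <;>
      simp [f, mJ_eq, join, iJ, pM, ji, mle _ _ (bi _).1, mle _ _ (bp _), mle _ _ (it _),
        mle _ _ (pt _).1, mle _ _ bt, mle _ _ (ip _ _).1]
  · rintro (_ | x | x | _) <;> simp [f, mN_eq, compl, Nb, Ni, Np, hb]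
  · obtain ⟨a, rfl⟩ | ⟨a, rfl⟩ | rfl | rfl := hsurj x
    exacts [⟨pos a, rfl⟩, ⟨neg a, rfl⟩, ⟨bot, rfl⟩, ⟨top, rfl⟩]

/-- A homomorphism between reflections maps the original Dunn monoid into the original
Dunn monoid. -/
theorem exists_map_pos {D : Type} [DunnLang.Structure D]
    (h : Refl A →[DMMLang] Refl D) (a : A) : ∃ d, h (pos a) = pos d := by
  have hE : h (neg dE) = neg dE := by
    have e := map_mN h mE
    rw [map_mE] at e
    exact e
  have ht : h top = top := by
    have e := map_mP h (neg dE) (neg dE)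
    rw [hE] at e
    exact e
  cases hx : h (pos a) with
  | bot =>
    have e := map_mP h (pos a) top
    rw [hx, ht] at e
    exact absurd (show top = bot from ht.symm.trans e) (by simp)
  | pos d => exact ⟨d, rfl⟩
  | neg d =>
    have e := map_mP h (pos a) (pos a)
    rw [hx] at e
    have e' := map_mM h (mP (pos a) (pos a)) (neg dE)
    rw [e, hE] at e'
    exact absurd (show top = neg dE from e.symm.trans e') (by simp)
  | top =>
    have e := map_mN h (pos a)
    rw [hx] at e
    have e' := map_mP h (mN (pos a)) top
    rw [e, ht] at e'
    exact absurd (show top = bot from ht.symm.trans e') (by simp)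

theorem exists_restrict {D : Type} [DunnLang.Structure D]
    (h : Refl A →[DMMLang] Refl D) : ∃ g : A →[DunnLang] D, ∀ a, h (pos a) = pos (g a) := by
  choose g hg using exists_map_pos h
  have hneg : ∀ a, h (neg a) = neg (g a) := fun a => by
    have e := map_mN h (pos a)
    rwa [hg] at e
  refine ⟨dunnHom g (fun a b => ?_) (fun a b => ?_) (fun a b => ?_) (fun a b => ?_) ?_, hg⟩
  · have e := map_mP h (pos a) (pos b)
    rw [hg, hg] at e
    exact pos.inj ((hg _).symm.trans e)
  · have e := map_mP h (pos a) (neg b)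
    rw [hg, hneg] at e
    exact neg.inj ((hneg _).symm.trans e)
  · have e := map_mM h (pos a) (pos b)
    rw [hg, hg] at e
    exact pos.inj ((hg _).symm.trans e)
  · have e := map_mJ h (pos a) (pos b)
    rw [hg, hg] at e
    exact pos.inj ((hg _).symm.trans e)
  · exact pos.inj ((hg _).symm.trans (map_mE h))

section Ultraproduct

attribute [local instance] piStructure

/-- The reflection of an ultraproduct is the ultraproduct of the reflections. -/
theorem exists_bijective_ultraproduct {ι : Type} (uf : Ultrafilter ι) (C : ι → Type)
    [∀ i, DunnLang.Structure (C i)] :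
    ∃ F : Refl ((uf : Filter ι).Product C) →[DMMLang]
      ((uf : Filter ι).Product fun i => Refl (C i)), Function.Bijective F := by
  let q : (∀ i, C i) →[DunnLang] (uf : Filter ι).Product C := ultraproductMk uf
  have hq : Function.Surjective (map q) := map_surjective q (ultraproductMk_surjective uf)
  let g : Refl (∀ i, C i) →[DMMLang] ((uf : Filter ι).Product fun i => Refl (C i)) :=
    (ultraproductMk uf).comp (liftHom fun i => map (projHom C i))
  have hg : ∀ z w, g z = g w ↔ ∀ᶠ i in uf, map (projHom C i) z = map (projHom C i) w :=
    fun z w => ultraproductMk_eq_iff (L := DMMLang) uf _ _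
  have hfact : ∀ z w, map q z = map q w → g z = g w := by
    rintro (_ | x | x | _) (_ | y | y | _) h <;> first | rfl | cases h | rw [hg]
    · filter_upwards [(ultraproductMk_eq_iff (L := DunnLang) uf x y).1 (pos.inj h)] with i hi
      exact congrArg pos hi
    · filter_upwards [(ultraproductMk_eq_iff (L := DunnLang) uf x y).1 (neg.inj h)] with i hi
      exact congrArg neg hi
  have hinj : ∀ z w, g z = g w → map q z = map q w := by
    intro z w h
    rw [hg] at h
    rcases z with _ | x | x | _ <;> rcases w with _ | y | y | _ <;>
      first
        | rfl
        | exact congrArg pos ((ultraproductMk_eq_iff (L := DunnLang) uf x y).2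
            (h.mono fun i hi => pos.inj hi))
        | exact congrArg neg ((ultraproductMk_eq_iff (L := DunnLang) uf x y).2
            (h.mono fun i hi => neg.inj hi))
        | (obtain ⟨i, hi⟩ := h.exists
           cases hi)
  choose r hr using hq
  obtain ⟨F, hF⟩ := exists_hom_of_comp_surjective (map q) (fun b => ⟨r b, hr b⟩) g
    (fun b => g (r b)) fun a => hfact _ _ (hr _)
  refine ⟨F, fun a b hab => ?_, fun y => ?_⟩
  · rw [hF] at hab
    rw [← hr a, ← hr b, hinj _ _ hab]
  · suffices ∃ z, g z = y by
      obtain ⟨z, rfl⟩ := this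
      exact ⟨map q z, by rw [hF]; exact hfact _ _ (hr _)⟩
    obtain ⟨y, rfl⟩ := ultraproductMk_surjective (L := DMMLang) uf y
    have key : ∀ z : Refl (∀ i, C i), (∀ᶠ i in uf, map (projHom C i) z = y i) →
        g z = ultraproductMk (L := DMMLang) uf y := fun z hz =>
      (ultraproductMk_eq_iff (L := DMMLang) uf _ _).2 hz
    have hcases : ∀ᶠ i in uf, (y i = bot ∨ y i = top) ∨
        ((∃ c, y i = pos c) ∨ ∃ c, y i = neg c) :=
      Filter.Eventually.of_forall fun i => by cases y i <;> simp
    classical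
    rw [Ultrafilter.eventually_or, Ultrafilter.eventually_or, Ultrafilter.eventually_or] at hcases
    rcases hcases with (h | h) | (h | h)
    · exact ⟨bot, key _ (h.mono fun i hi => hi.symm)⟩
    · exact ⟨top, key _ (h.mono fun i hi => hi.symm)⟩
    · refine ⟨pos fun i => if hi : ∃ c, y i = pos c then hi.choose else dE, key _ ?_⟩
      filter_upwards [h] with i hi
      refine Eq.trans ?_ hi.choose_spec.symm
      exact congrArg pos (dif_pos hi)
    · refine ⟨neg fun i => if hi : ∃ c, y i = neg c then hi.choose else dE, key _ ?_⟩
      filter_upwards [h] with i hi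
      refine Eq.trans ?_ hi.choose_spec.symm
      exact congrArg neg (dif_pos hi)

end Ultraproduct

end Refl

/-- The class of algebras whose points are separated by homomorphisms into reflections of members
of `K`. -/
def ReflSeparated (K : StructClass DunnLang) : StructClass DMMLang :=
  fun B iB => ∀ a b : B, a ≠ b → ∃ (C : Type) (iC : DunnLang.Structure C), K C iC ∧
    ∃ h : @FirstOrder.Language.Hom DMMLang B (Refl C) iB _, h a ≠ h b

theorem IsQuasivariety.reflSeparated {K : StructClass DunnLang} (hK : IsQuasivariety K) :
    IsQuasivariety (ReflSeparated K) where
  iso_closed := by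
    rintro M iM N iN ⟨e⟩ hM a b hab
    obtain ⟨C, iC, hC, h, hh⟩ := hM (e.symm a) (e.symm b) (e.symm.injective.ne hab)
    exact ⟨C, iC, hC, h.comp e.symm.toHom, hh⟩
  sub_closed := by
    rintro M iM N iN ⟨e⟩ hN a b hab
    obtain ⟨C, iC, hC, h, hh⟩ := hN (e a) (e b) (e.injective.ne hab)
    exact ⟨C, iC, hC, h.comp e.toHom, hh⟩
  prod_closed := by
    intro ι M iM hM a b hab
    obtain ⟨i, hi⟩ := Function.ne_iff.1 hab
    obtain ⟨C, iC, hC, h, hh⟩ := hM i _ _ hi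
    let _ := piStructure (L := DMMLang) M
    exact ⟨C, iC, hC, h.comp (projHom M i), hh⟩
  ultra_closed := by
    intro ι M iM uf hM a b hab
    obtain ⟨x, rfl⟩ := ultraproductMk_surjective (L := DMMLang) uf a
    obtain ⟨y, rfl⟩ := ultraproductMk_surjective (L := DMMLang) uf b
    rw [Ne, ultraproductMk_eq_iff, ← Ultrafilter.eventually_not] at hab
    have hsep : ∀ i, ∃ (C : Type) (iC : DunnLang.Structure C), K C iC ∧
        ∃ f : M i → Refl C, x i ≠ y i →
          (∃ g : M i →[DMMLang] Refl C, ⇑g = f) ∧ f (x i) ≠ f (y i) := by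
      intro i
      by_cases hi : x i = y i
      · exact ⟨_, _, hK.prod_closed Empty (fun j => j.elim) (iM := fun j => j.elim)
          fun j => j.elim, fun _ => Refl.bot, fun h => absurd hi h⟩
      · obtain ⟨C, iC, hC, h, hh⟩ := hM i _ _ hi
        exact ⟨C, iC, hC, h, fun _ => ⟨⟨h, rfl⟩, hh⟩⟩
    choose C iC hC f hf using hsep
    obtain ⟨F, hF⟩ := exists_ultraproduct_hom (L := DMMLang) uf f
      (hab.mono fun i hi => (hf i hi).1)
    obtain ⟨G, hG⟩ := Refl.exists_bijective_ultraproduct uf C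
    obtain ⟨G', hG'⟩ := exists_inverse_hom G hG
    refine ⟨_, inferInstance, hK.ultra_closed ι C uf hC, G'.comp F, fun h => ?_⟩
    have h' := congrArg G h
    rw [Hom.comp_apply, Hom.comp_apply, hG', hG', hF, hF, ultraproductMk_eq_iff] at h'
    obtain ⟨i, hi, hi'⟩ := (h'.and hab).exists
    exact (hf i hi').2 hi

/-- for a variety `K` of Dunn monoids, if the reflection
`R(K) = V{R(A) : A ∈ K}` is structurally complete, then so is `K`. -/
theorem statement_17 (K : StructClass DunnLang) (hK : IsVariety K)
    (hdunn : ∀ (A : Type) (iA : DunnLang.Structure A), K A iA → @IsDunn A iA) :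
    IsSC (VGen (ReflClass K)) → IsSC K := by
  intro hR K' hK' hsub hV
  have hrefl : ∀ (A : Type) (iA : DunnLang.Structure A), K A iA →
      ReflClass K (Refl A) inferInstance :=
    fun A iA hA => ⟨A, iA, hA, Refl.isReflectionOf (hdunn A iA hA)⟩
  have hle : SubClass (ReflSeparated K') (VGen (ReflClass K)) := by
    intro B iB hB
    have hvar := isVariety_vGen (ReflClass K)
    refine mem_of_separated hvar.sub_closed hvar.prod_closed B fun a b hab => ?_
    obtain ⟨C, iC, hC, h, hh⟩ := hB a b hab
    exact ⟨Refl C, inferInstance, subClass_vGen _ _ _ (hrefl C iC (hsub C iC hC)), h, hh⟩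
  have hgen : SubClass (ReflClass K) (VGen (ReflSeparated K')) := by
    rintro T iT ⟨A, iA, hA, hT⟩
    obtain ⟨B, iB, hB, f, hf⟩ := (hV A iA).2 (subClass_vGen K A iA hA) _
      hK'.isVariety_homImages fun M iM hM => ⟨M, iM, hM, Hom.id _ _, Function.surjective_id⟩
    obtain ⟨g, hg⟩ := Refl.exists_surjective_of_isReflectionOf T hT
    refine (isVariety_vGen _).hom_closed (Refl B) T
      ⟨g.comp (Refl.map f), hg.comp (Refl.map_surjective f hf)⟩ (subClass_vGen _ _ _ ?_)
    exact fun a b hab => ⟨B, iB, hB, Hom.id _ _, hab⟩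
  have hsep : EqClass (ReflSeparated K') (VGen (ReflClass K)) :=
    hR _ hK'.reflSeparated hle fun B iB =>
      ⟨fun hB V hV' hVS => hB V hV' fun M iM hM => hVS M iM (hle M iM hM),
        fun hB => hB _ (isVariety_vGen _) fun M iM hM => hM _ (isVariety_vGen _) hgen⟩
  refine fun A iA => ⟨hsub A iA, fun hA => ?_⟩
  have hsepA := (hsep (Refl A) inferInstance).2 (subClass_vGen _ _ _ (hrefl A iA hA))
  refine mem_of_separated hK'.sub_closed hK'.prod_closed A fun a b hab => ?_
  obtain ⟨C, iC, hC, h, hh⟩ := hsepA (Refl.pos a) (Refl.pos b) fun e => hab (Refl.pos.inj e)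
  obtain ⟨g, hg⟩ := Refl.exists_restrict h
  exact ⟨C, iC, hC, g, fun e => hh (by rw [hg, hg, e])⟩

end Paper
end
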